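/- Let L be a countable language and let Σ ⊆ L_{ω,ω}(L) be a set of first-order sentences. Then there is an S∞-invariant probability measure on Str_L concentrated on the class of models of Σ in Str_L if and only if there is a complete consistent first-order theory T ⊆ L_{ω,ω}(L) with Σ ⊆ T such that T has trivial L_{ω,ω}(L)-definable closure. -/

import Mathlib

open FirstOrder MeasureTheory

namespace AFP

/-! ### Syntax of `L_{ω₁,ω}(L)` -/

/-- The set of variables occurring in a term. -/
def termVars {L : FirstOrder.Language.{0,0}} : L.Term ℕ → Set ℕ
  | .var i => {i}
  | .func _f ts => ⋃ i, termVars (ts i)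

/-- Formulas of `L_{ω₁,ω}(L)`, with (free and bound) variables indexed by `ℕ`,
built from atomic formulas using `∧`, countable `⋀`, `¬` and `∃`;
the connectives `∨`, `⋁`, `∀` are regarded as the usual shorthands. -/
inductive InfForm (L : FirstOrder.Language.{0,0}) : Type where
  | equal : L.Term ℕ → L.Term ℕ → InfForm L
  | rel : {n : ℕ} → L.Relations n → (Fin n → L.Term ℕ) → InfForm L
  | not : InfForm L → InfForm L
  | and : InfForm L → InfForm L → InfForm L
  | iand : (ℕ → InfForm L) → InfForm L
  | ex : ℕ → InfForm L → InfForm L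

variable {L : FirstOrder.Language.{0,0}}

/-- The free variables of an `L_{ω₁,ω}` formula. -/
def freeVars : InfForm L → Set ℕ
  | .equal t₁ t₂ => termVars t₁ ∪ termVars t₂
  | .rel _ ts => ⋃ i, termVars (ts i)
  | .not φ => freeVars φ
  | .and φ ψ => freeVars φ ∪ freeVars ψ
  | .iand f => ⋃ n, freeVars (f n)
  | .ex i φ => freeVars φ \ {i}

/-- A sentence is a formula with no free variables. -/
def IsSentence (φ : InfForm L) : Prop := freeVars φ = ∅

/-- A first-order formula is one without infinitary conjunctions. -/
def IsFirstOrder : InfForm L → Prop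
  | .equal _ _ => True
  | .rel _ _ => True
  | .not φ => IsFirstOrder φ
  | .and φ ψ => IsFirstOrder φ ∧ IsFirstOrder ψ
  | .iand _ => False
  | .ex _ φ => IsFirstOrder φ

/-- Satisfaction of an `L_{ω₁,ω}` formula in an `L`-structure `S` on `M`,
under the variable assignment `v`. -/
def Sat {M : Type} (S : L.Structure M) : InfForm L → (ℕ → M) → Prop
  | .equal t₁ t₂, v =>
      @FirstOrder.Language.Term.realize L M S ℕ v t₁ =
        @FirstOrder.Language.Term.realize L M S ℕ v t₂
  | .rel R ts, v =>
      @FirstOrder.Language.Structure.RelMap L M S _ R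
        (fun i => @FirstOrder.Language.Term.realize L M S ℕ v (ts i))
  | .not φ, v => ¬ Sat S φ v
  | .and φ ψ, v => Sat S φ v ∧ Sat S ψ v
  | .iand f, v => ∀ n, Sat S (f n) v
  | .ex i φ, v => ∃ a, Sat S φ (Function.update v i a)

/-- `M` (with interpretation `S`) is a model of the set of sentences `T`. -/
def IsModel {M : Type} (S : L.Structure M) (T : Set (InfForm L)) : Prop :=
  ∀ φ ∈ T, ∀ v : ℕ → M, Sat S φ v

/-- A set of sentences is consistent (satisfiable) if it has a model. -/
def Consistent (T : Set (InfForm L)) : Prop :=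
  ∃ (M : Type) (S : L.Structure M), Nonempty M ∧ IsModel S T

/-- Semantic consequence: every model of `T` satisfies `φ`. -/
def Consequence (T : Set (InfForm L)) (φ : InfForm L) : Prop :=
  ∀ (M : Type) (S : L.Structure M), Nonempty M → IsModel S T → ∀ v : ℕ → M, Sat S φ v

/-- A fragment of `L_{ω₁,ω}(L)`: a set of formulas closed under subformulas and
under the logical operations (`∨` and `∀` being shorthands in terms of `∧,¬,∃`). -/
def IsFragment (A : Set (InfForm L)) : Prop :=
  (∀ φ ψ : InfForm L, InfForm.and φ ψ ∈ A → φ ∈ A ∧ ψ ∈ A) ∧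
  (∀ φ : InfForm L, InfForm.not φ ∈ A → φ ∈ A) ∧
  (∀ f : ℕ → InfForm L, InfForm.iand f ∈ A → ∀ n, f n ∈ A) ∧
  (∀ (i : ℕ) (φ : InfForm L), InfForm.ex i φ ∈ A → φ ∈ A) ∧
  (∀ φ ψ : InfForm L, φ ∈ A → ψ ∈ A → InfForm.and φ ψ ∈ A) ∧
  (∀ φ : InfForm L, φ ∈ A → InfForm.not φ ∈ A) ∧
  (∀ (i : ℕ) (φ : InfForm L), φ ∈ A → InfForm.ex i φ ∈ A)

/-- `T` is complete for the fragment `A`: it decides every sentence of `A`. -/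
def CompleteFor (A T : Set (InfForm L)) : Prop :=
  ∀ φ ∈ A, IsSentence φ → (Consequence T φ ∨ Consequence T (InfForm.not φ))

/-- `T ⊨ (∀ x₀ ⋯ x_{k-1}) (∃^{=1} x_k) φ`: in every model of `T`, every assignment of the
variables `x₀, …, x_{k-1}` admits a unique witness for the variable `x_k` satisfying `φ`. -/
def UniqueY (T : Set (InfForm L)) (φ : InfForm L) (k : ℕ) : Prop :=
  ∀ (N : Type) (S : L.Structure N), Nonempty N → IsModel S T →
    ∀ w : ℕ → N, ∃! b : N, Sat S φ (Function.update w k b)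

/-- `b` is in the `A`-definable closure of `X` (in the model `S` of `T`): there is a formula
`φ(x₀,…,x_{k-1}, x_k) ∈ A` and a tuple from `X` witnessing `φ` at `b`, such that
`T ⊨ (∀ x̄)(∃^{=1} y) φ(x̄, y)`. -/
def InDcl (A T : Set (InfForm L)) {M : Type} (S : L.Structure M) (X : Set M) (b : M) : Prop :=
  ∃ φ ∈ A, ∃ k : ℕ, freeVars φ ⊆ Set.Iic k ∧ UniqueY T φ k ∧
    ∃ v : ℕ → M, (∀ i < k, v i ∈ X) ∧ v k = b ∧ Sat S φ v

/-- `T` has trivial `A`-definable closure: in every model of `T`, the `A`-definable closure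
of any set `X` is `X` itself, i.e. it contains no additional elements. -/
def HasTrivialDcl (A T : Set (InfForm L)) : Prop :=
  ∀ (M : Type) (S : L.Structure M), Nonempty M → IsModel S T →
    ∀ (X : Set M) (b : M), InDcl A T S X b → b ∈ X

/-! ### The space `Str_L` of `L`-structures with underlying set `ℕ` -/

/-- An `L`-structure with underlying set `ℕ`, presented as a point of a measurable space. -/
structure Str (L : FirstOrder.Language.{0,0}) : Type where
  func : ∀ n, L.Functions n → (Fin n → ℕ) → ℕ
  rel : ∀ n, L.Relations n → (Fin n → ℕ) → Bool

/-- The σ-algebra on `Str L` generated by the atomic-formula events. -/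
instance : MeasurableSpace (Str L) :=
  MeasurableSpace.generateFrom
    ({s | ∃ (n : ℕ) (f : L.Functions n) (t : Fin n → ℕ) (k : ℕ),
        s = {M : Str L | M.func n f t = k}} ∪
     {s | ∃ (n : ℕ) (R : L.Relations n) (t : Fin n → ℕ),
        s = {M : Str L | M.rel n R t = true}})

/-- The `L`-structure on `ℕ` determined by a point of `Str L`. -/
def Str.toStructure (M : Str L) : L.Structure ℕ where
  funMap := fun {n} f t => M.func n f t
  RelMap := fun {n} R t => M.rel n R t = true

/-- The logic action of `S∞` (permutations of `ℕ`) on `Str L`. -/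
def permStr (g : Equiv.Perm ℕ) (M : Str L) : Str L where
  func := fun n f t => g (M.func n f fun i => g.symm (t i))
  rel := fun n R t => M.rel n R fun i => g.symm (t i)

/-- A measure on `Str L` is invariant when it is invariant under the logic action of `S∞`. -/
def IsInvariant (μ : Measure (Str L)) : Prop :=
  ∀ (g : Equiv.Perm ℕ) (s : Set (Str L)), MeasurableSet s → μ (permStr g ⁻¹' s) = μ s

/-- A measure `μ` on `Str L` is ergodic when every Borel set that is almost invariant under
every element of `S∞` has measure `0` or `1`. -/
def IsErgodicInv (μ : Measure (Str L)) : Prop :=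
  ∀ s : Set (Str L), MeasurableSet s →
    (∀ g : Equiv.Perm ℕ, μ (symmDiff s (permStr g ⁻¹' s)) = 0) → (μ s = 0 ∨ μ s = 1)

/-- `⟦Σ⟧`: the class of models of the theory `Σ` inside `Str L`. -/
def modelSet (T : Set (InfForm L)) : Set (Str L) :=
  {M : Str L | IsModel M.toStructure T}

/-- The theory of an (ergodic) measure: all sentences of `L_{ω₁,ω}(L)` holding almost surely. -/
def ThOf (μ : Measure (Str L)) : Set (InfForm L) :=
  {φ : InfForm L | IsSentence φ ∧ μ (modelSet {φ}) = 1}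

/-! ### Non-redundancy and duplication of formulas -/

/-- A formula (whose displayed free variables are `x₀, …, x_{k-1}`) is non-redundant if it
implies that its free variables take pairwise distinct values. -/
def NonRedundantIn (φ : InfForm L) (k : ℕ) : Prop :=
  ∀ (M : Type) (S : L.Structure M) (v : ℕ → M), Sat S φ v →
    ∀ i < k, ∀ j < k, i ≠ j → v i ≠ v j

/-- A formula is non-redundant if it implies that its free variables take pairwise
distinct values. -/
def NonRedundant (φ : InfForm L) : Prop :=
  ∀ (M : Type) (S : L.Structure M) (v : ℕ → M), Sat S φ v →
    ∀ i ∈ freeVars φ, ∀ j ∈ freeVars φ, i ≠ j → v i ≠ v j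

/-- `φ` is consistent with `T`: some model of `T` realizes `φ`. -/
def ConsistentWith (T : Set (InfForm L)) (φ : InfForm L) : Prop :=
  ∃ (M : Type) (S : L.Structure M), Nonempty M ∧ IsModel S T ∧ ∃ v : ℕ → M, Sat S φ v

/-- `T` duplicates `φ` at the free variable `y`:
`T ⊨ (∃ x̄, y, z)(φ(x̄,y) ∧ φ(x̄,z) ∧ y ≠ z)`. -/
def Duplicates (T : Set (InfForm L)) (φ : InfForm L) (y : ℕ) : Prop :=
  ∀ (M : Type) (S : L.Structure M), Nonempty M → IsModel S T →
    ∃ (v : ℕ → M) (b c : M), b ≠ c ∧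
      Sat S φ (Function.update v y b) ∧ Sat S φ (Function.update v y c)

/-- `T` has duplication of formulas in `A`: it duplicates every non-redundant formula in `A`
consistent with `T`. -/
def DuplicationOfFormulas (A T : Set (InfForm L)) : Prop :=
  ∀ φ ∈ A, NonRedundant φ → ConsistentWith T φ → ∀ y ∈ freeVars φ, Duplicates T φ y

/-! ### Finiteness of free variables, and countability of first-order formulas -/

lemma termVars_finite (t : L.Term ℕ) : (termVars t).Finite := by
  induction t with
  | var i => exact Set.finite_singleton i
  | func f ts ih => exact Set.finite_iUnion ih

lemma realize_congr {M : Type} (S : L.Structure M) (t : L.Term ℕ) {v w : ℕ → M}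
    (h : ∀ i ∈ termVars t, v i = w i) : t.realize v = t.realize w := by
  induction t with
  | var i => exact h i rfl
  | func f ts ih =>
    simp only [Language.Term.realize]
    congr 1
    funext i
    exact ih i fun j hj => h j (Set.mem_iUnion.2 ⟨i, hj⟩)

lemma freeVars_finite {φ : InfForm L} (h : IsFirstOrder φ) : (freeVars φ).Finite := by
  induction φ with
  | equal t₁ t₂ => exact (termVars_finite t₁).union (termVars_finite t₂)
  | rel R ts => exact Set.finite_iUnion fun i => termVars_finite (ts i)
  | not φ ih => exact ih h
  | and φ ψ ih₁ ih₂ => exact (ih₁ h.1).union (ih₂ h.2)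
  | iand f ih => exact h.elim
  | ex i φ ih => exact (ih h).subset Set.sdiff_subset

lemma sat_congr {M : Type} (S : L.Structure M) (φ : InfForm L) {v w : ℕ → M}
    (h : ∀ i ∈ freeVars φ, v i = w i) : Sat S φ v ↔ Sat S φ w := by
  induction φ generalizing v w with
  | equal t₁ t₂ =>
    simp only [Sat]
    rw [realize_congr S t₁ fun i hi => h i (Or.inl hi),
      realize_congr S t₂ fun i hi => h i (Or.inr hi)]
  | rel R ts =>
    simp only [Sat]
    have : (fun i => (ts i).realize v) = fun i => (ts i).realize w := by
      funext i
      exact realize_congr S (ts i) fun j hj => h j (Set.mem_iUnion.2 ⟨i, hj⟩)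
    rw [this]
  | not φ ih => exact not_congr (ih h)
  | and φ ψ ih₁ ih₂ =>
    exact and_congr (ih₁ fun i hi => h i (Or.inl hi)) (ih₂ fun i hi => h i (Or.inr hi))
  | iand f ih =>
    exact forall_congr' fun n => ih n fun i hi => h i (Set.mem_iUnion.2 ⟨n, hi⟩)
  | ex i φ ih =>
    refine exists_congr fun a => ih fun j hj => ?_
    by_cases hji : j = i
    · subst hji; simp
    · simp only [Function.update_of_ne hji]
      exact h j ⟨hj, hji⟩

lemma IsSentence.sat_iff {M : Type} (S : L.Structure M) {φ : InfForm L} (h : IsSentence φ)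
    (v w : ℕ → M) : Sat S φ v ↔ Sat S φ w :=
  sat_congr S φ fun i hi => by rw [h] at hi; exact hi.elim

/-- First-order formulas built with at most `n` nested connectives. -/
def formsOfDepth (L : FirstOrder.Language.{0,0}) : ℕ → Set (InfForm L)
  | 0 => Set.range (fun p : L.Term ℕ × L.Term ℕ => InfForm.equal p.1 p.2) ∪
      Set.range (fun p : Σ R : (Σ n, L.Relations n), Fin R.1 → L.Term ℕ => InfForm.rel p.1.2 p.2)
  | n + 1 => formsOfDepth L n ∪ InfForm.not '' formsOfDepth L n ∪
      Set.image2 InfForm.and (formsOfDepth L n) (formsOfDepth L n) ∪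
      Set.image2 InfForm.ex Set.univ (formsOfDepth L n)

lemma formsOfDepth_countable [Countable (Σ n, L.Functions n)] [Countable (Σ n, L.Relations n)]
    (n : ℕ) : (formsOfDepth L n).Countable := by
  induction n with
  | zero => exact (Set.countable_range _).union (Set.countable_range _)
  | succ n ih =>
    exact ((ih.union (ih.image _)).union (ih.image2 ih _)).union
      (Set.Countable.image2 Set.countable_univ ih _)

lemma formsOfDepth_mono : Monotone (formsOfDepth L) :=
  monotone_nat_of_le_succ fun _ _ h => Or.inl (Or.inl (Or.inl h))

lemma IsFirstOrder.exists_depth {φ : InfForm L} (h : IsFirstOrder φ) :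
    ∃ n, φ ∈ formsOfDepth L n := by
  induction φ with
  | equal t₁ t₂ => exact ⟨0, Or.inl ⟨(t₁, t₂), rfl⟩⟩
  | rel R ts => exact ⟨0, Or.inr ⟨⟨⟨_, R⟩, ts⟩, rfl⟩⟩
  | not φ ih =>
    obtain ⟨n, hn⟩ := ih h
    exact ⟨n + 1, Or.inl (Or.inl (Or.inr ⟨φ, hn, rfl⟩))⟩
  | and φ ψ ih₁ ih₂ =>
    obtain ⟨n, hn⟩ := ih₁ h.1
    obtain ⟨m, hm⟩ := ih₂ h.2
    exact ⟨max n m + 1, Or.inl (Or.inr ⟨φ, formsOfDepth_mono (le_max_left n m) hn,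
      ψ, formsOfDepth_mono (le_max_right n m) hm, rfl⟩)⟩
  | iand f ih => exact h.elim
  | ex i φ ih =>
    obtain ⟨n, hn⟩ := ih h
    exact ⟨n + 1, Or.inr ⟨i, trivial, φ, hn, rfl⟩⟩

lemma countable_firstOrder [Countable (Σ n, L.Functions n)] [Countable (Σ n, L.Relations n)] :
    {φ : InfForm L | IsFirstOrder φ}.Countable :=
  (Set.countable_iUnion formsOfDepth_countable).mono fun _ h =>
    Set.mem_iUnion.2 (IsFirstOrder.exists_depth h)

/-! ### First-order expressible predicates -/

/-- A predicate of assignments in `M` is first-order if it is defined by a first-order formula. -/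
def IsFO {M : Type} (S : L.Structure M) (P : (ℕ → M) → Prop) : Prop :=
  ∃ φ : InfForm L, IsFirstOrder φ ∧ ∀ v, Sat S φ v ↔ P v

/-- `P` depends only on the values of variables below `m`. -/
def DependsBelow {M : Type} (P : (ℕ → M) → Prop) (m : ℕ) : Prop :=
  ∀ v w : ℕ → M, (∀ i < m, v i = w i) → (P v ↔ P w)

/-- Rename the variables of a formula, bound ones included. -/
def renameVars (ρ : ℕ → ℕ) : InfForm L → InfForm L
  | .equal t₁ t₂ => .equal (t₁.relabel ρ) (t₂.relabel ρ)
  | .rel R ts => .rel R fun i => (ts i).relabel ρ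
  | .not φ => .not (renameVars ρ φ)
  | .and φ ψ => .and (renameVars ρ φ) (renameVars ρ ψ)
  | .iand f => .iand fun n => renameVars ρ (f n)
  | .ex i φ => .ex (ρ i) (renameVars ρ φ)

lemma isFirstOrder_renameVars (ρ : ℕ → ℕ) {φ : InfForm L} (h : IsFirstOrder φ) :
    IsFirstOrder (renameVars ρ φ) := by
  induction φ with
  | equal t₁ t₂ => trivial
  | rel R ts => trivial
  | not φ ih => exact ih h
  | and φ ψ ih₁ ih₂ => exact ⟨ih₁ h.1, ih₂ h.2⟩
  | iand f ih => exact h.elim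
  | ex i φ ih => exact ih h

lemma sat_renameVars {M : Type} (S : L.Structure M) {ρ : ℕ → ℕ} (hρ : Function.Injective ρ)
    (φ : InfForm L) (v : ℕ → M) : Sat S (renameVars ρ φ) v ↔ Sat S φ (v ∘ ρ) := by
  induction φ generalizing v with
  | equal t₁ t₂ => simp only [renameVars, Sat, Language.Term.realize_relabel]
  | rel R ts => simp only [renameVars, Sat, Language.Term.realize_relabel]
  | not φ ih => exact not_congr (ih v)
  | and φ ψ ih₁ ih₂ => exact and_congr (ih₁ v) (ih₂ v)
  | iand f ih => exact forall_congr' fun n => ih n v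
  | ex i φ ih =>
    refine exists_congr fun a => (ih _).trans ?_
    rw [Function.update_comp_eq_of_injective v hρ i a]

namespace IsFO

variable {M : Type} {S : L.Structure M} {P Q : (ℕ → M) → Prop}

lemma congr (h : IsFO S P) (hPQ : ∀ v, P v ↔ Q v) : IsFO S Q := by
  obtain ⟨φ, hφ, h⟩ := h
  exact ⟨φ, hφ, fun v => (h v).trans (hPQ v)⟩

lemma not (h : IsFO S P) : IsFO S fun v => ¬ P v := by
  obtain ⟨φ, hφ, h⟩ := h
  exact ⟨.not φ, hφ, fun v => not_congr (h v)⟩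

lemma and (hP : IsFO S P) (hQ : IsFO S Q) : IsFO S fun v => P v ∧ Q v := by
  obtain ⟨φ, hφ, hP⟩ := hP
  obtain ⟨ψ, hψ, hQ⟩ := hQ
  exact ⟨.and φ ψ, ⟨hφ, hψ⟩, fun v => and_congr (hP v) (hQ v)⟩

lemma or (hP : IsFO S P) (hQ : IsFO S Q) : IsFO S fun v => P v ∨ Q v :=
  (hP.not.and hQ.not).not.congr fun v => by tauto

lemma ex (h : IsFO S P) (i : ℕ) : IsFO S fun v => ∃ a, P (Function.update v i a) := by
  obtain ⟨φ, hφ, h⟩ := h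
  exact ⟨.ex i φ, hφ, fun v => exists_congr fun a => h _⟩

lemma eq (S : L.Structure M) (i j : ℕ) : IsFO S fun v => v i = v j :=
  ⟨.equal (.var i) (.var j), trivial, fun _ => Iff.rfl⟩

lemma true (S : L.Structure M) : IsFO S fun _ => True :=
  (eq S 0 0).congr fun v => by simp

lemma all_mem {ι : Type*} {s : Set ι} (hs : s.Finite) {R : ι → (ℕ → M) → Prop}
    (h : ∀ i ∈ s, IsFO S (R i)) : IsFO S fun v => ∀ i ∈ s, R i v := by
  induction s, hs using Set.Finite.induction_on with
  | empty => exact (IsFO.true S).congr fun v => by simp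
  | insert ha hs ih =>
    refine ((h _ (Set.mem_insert _ _)).and (ih fun i hi => h i (Set.mem_insert_of_mem _ hi))).congr
      fun v => by simp

lemma dependsBelow (h : IsFO S P) : ∃ m, DependsBelow P m := by
  obtain ⟨φ, hφ, h⟩ := h
  obtain ⟨m, hm⟩ := (freeVars_finite hφ).bddAbove
  refine ⟨m + 1, fun v w hvw => ?_⟩
  rw [← h, ← h]
  exact sat_congr S φ fun i hi => hvw i (Nat.lt_succ_of_le (hm hi))

lemma rename_injective (h : IsFO S P) {ρ : ℕ → ℕ} (hρ : Function.Injective ρ) :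
    IsFO S fun v => P (v ∘ ρ) := by
  obtain ⟨φ, hφ, h⟩ := h
  exact ⟨renameVars ρ φ, isFirstOrder_renameVars ρ hφ, fun v => (sat_renameVars S hρ φ v).trans (h _)⟩

lemma subst (h : IsFO S P) {i j : ℕ} (hij : i ≠ j) :
    IsFO S fun v => P (Function.update v i (v j)) :=
  (((eq S i j).and h).ex i).congr fun v => by
    simp only [Function.update_self, Function.update_of_ne hij.symm]
    exact ⟨fun ⟨a, ha, hP⟩ => ha ▸ hP, fun hP => ⟨_, rfl, hP⟩⟩

lemma rename (h : IsFO S P) (σ : ℕ → ℕ) : IsFO S fun v => P (v ∘ σ) := by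
  obtain ⟨m, hm⟩ := h.dependsBelow
  obtain ⟨N, hN⟩ : ∃ N, ∀ i < m, σ i < N :=
    ⟨(Finset.range m).sup σ + 1, fun i hi =>
      Nat.lt_succ_of_le (Finset.le_sup (f := σ) (Finset.mem_range.2 hi))⟩
  have key : ∀ k ≤ m, IsFO S fun v : ℕ → M => P fun i => if i < k then v (σ i) else v (N + i) := by
    intro k
    induction k with
    | zero =>
      intro _
      exact (h.rename_injective (add_right_injective N)).congr fun v => by
        simp [Function.comp_def]
    | succ k ih =>
      intro hk
      have hlt := hN k hk
      refine ((ih (by omega)).subst (i := N + k) (j := σ k) (by omega)).congr fun v => ?_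
      refine hm _ _ fun i hi => ?_
      have := hN i hi
      rcases lt_trichotomy i k with h1 | h1 | h1
      · rw [if_pos h1, if_pos (by omega), Function.update_of_ne (by omega)]
      · subst h1; simp
      · rw [if_neg (by omega), if_neg (by omega), Function.update_of_ne (by omega)]
  exact (key m le_rfl).congr fun v => hm _ _ fun i hi => by simp [hi]

end IsFO

lemma isFO_sat {M : Type} (S : L.Structure M) {φ : InfForm L} (h : IsFirstOrder φ) :
    IsFO S (Sat S φ) :=
  ⟨φ, h, fun _ => Iff.rfl⟩

/-! ### Existential closures -/

/-- Existential quantification over the variables below `m`. -/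
def exsBelow : ℕ → InfForm L → InfForm L
  | 0, φ => φ
  | m + 1, φ => exsBelow m (.ex m φ)

lemma isFirstOrder_exsBelow (m : ℕ) {φ : InfForm L} (h : IsFirstOrder φ) :
    IsFirstOrder (exsBelow m φ) := by
  induction m generalizing φ with
  | zero => exact h
  | succ m ih => exact ih (φ := .ex m φ) h

lemma freeVars_exsBelow (m : ℕ) (φ : InfForm L) : freeVars (exsBelow m φ) = freeVars φ \ Set.Iio m := by
  induction m generalizing φ with
  | zero => simp [exsBelow]
  | succ m ih =>
    rw [exsBelow, ih]
    ext i
    simp only [freeVars, Set.mem_sdiff, Set.mem_singleton_iff, Set.mem_Iio]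
    constructor
    · rintro ⟨⟨h1, h2⟩, h3⟩
      exact ⟨h1, by omega⟩
    · rintro ⟨h1, h2⟩
      exact ⟨⟨h1, by omega⟩, by omega⟩

lemma sat_exsBelow {M : Type} (S : L.Structure M) (m : ℕ) (φ : InfForm L) (v : ℕ → M) :
    Sat S (exsBelow m φ) v ↔ ∃ w, (∀ i, m ≤ i → w i = v i) ∧ Sat S φ w := by
  induction m generalizing φ v with
  | zero =>
    refine ⟨fun h => ⟨v, fun _ _ => rfl, h⟩, fun ⟨w, hw, h⟩ => ?_⟩
    obtain rfl : w = v := funext fun i => hw i (Nat.zero_le i)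
    exact h
  | succ m ih =>
    rw [exsBelow, ih]
    constructor
    · rintro ⟨w, hw, a, h⟩
      refine ⟨Function.update w m a, fun i hi => ?_, h⟩
      rw [Function.update_of_ne (by omega)]
      exact hw i (by omega)
    · rintro ⟨w, hw, h⟩
      refine ⟨Function.update w m (v m), fun i hi => ?_, w m, by simpa using h⟩
      rcases hi.eq_or_lt with rfl | hi
      · simp
      · rw [Function.update_of_ne (by omega)]
        exact hw i hi

lemma isSentence_exsBelow {m : ℕ} {φ : InfForm L} (h : freeVars φ ⊆ Set.Iio m) :
    IsSentence (exsBelow m φ) := by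
  rw [IsSentence, freeVars_exsBelow, Set.sdiff_eq_empty]
  exact h

lemma sat_exsBelow_iff {M : Type} (S : L.Structure M) {m : ℕ} {φ : InfForm L}
    (h : freeVars φ ⊆ Set.Iio m) (v : ℕ → M) :
    Sat S (exsBelow m φ) v ↔ ∃ w, Sat S φ w := by
  rw [sat_exsBelow]
  refine ⟨fun ⟨w, _, hw⟩ => ⟨w, hw⟩, fun ⟨w, hw⟩ => ?_⟩
  refine ⟨fun i => if i < m then w i else v i, fun i hi => if_neg (by omega), ?_⟩
  exact (sat_congr S φ fun i hi => if_pos (h hi)).2 hw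

/-- The conjunction of `φ` with `x_i ≠ x_k` for `i < j`. -/
def andNe (φ : InfForm L) (k : ℕ) : ℕ → InfForm L
  | 0 => φ
  | j + 1 => .and (andNe φ k j) (.not (.equal (.var j) (.var k)))

lemma isFirstOrder_andNe {φ : InfForm L} (h : IsFirstOrder φ) (k j : ℕ) :
    IsFirstOrder (andNe φ k j) := by
  induction j with
  | zero => exact h
  | succ j ih => exact ⟨ih, trivial⟩

lemma freeVars_andNe {φ : InfForm L} {k : ℕ} (h : freeVars φ ⊆ Set.Iic k) (j : ℕ) (hj : j ≤ k) :
    freeVars (andNe φ k j) ⊆ Set.Iic k := by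
  induction j with
  | zero => exact h
  | succ j ih =>
    refine Set.union_subset (ih (by omega)) (Set.union_subset ?_ ?_)
    · exact Set.singleton_subset_iff.2 (Set.mem_Iic.2 (by omega))
    · exact Set.singleton_subset_iff.2 (Set.mem_Iic.2 le_rfl)

lemma sat_andNe {M : Type} (S : L.Structure M) (φ : InfForm L) (k j : ℕ) (v : ℕ → M) :
    Sat S (andNe φ k j) v ↔ Sat S φ v ∧ ∀ i < j, v i ≠ v k := by
  induction j with
  | zero => simp [andNe]
  | succ j ih =>
    simp only [andNe, Sat, ih, Language.Term.realize_var, Nat.lt_succ_iff_lt_or_eq, and_assoc]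
    refine and_congr_right fun _ => ⟨?_, fun h => ⟨fun i hi => h i (Or.inl hi), h j (Or.inr rfl)⟩⟩
    rintro ⟨h1, h2⟩ i (hi | rfl)
    · exact h1 i hi
    · exact h2

/-! ### From an invariant measure to a theory with trivial definable closure -/

lemma measurableSet_realize (t : L.Term ℕ) (v : ℕ → ℕ) (k : ℕ) :
    MeasurableSet {M : Str L | @Language.Term.realize L ℕ M.toStructure ℕ v t = k} := by
  induction t generalizing k with
  | var i =>
    simp only [Language.Term.realize_var]
    exact MeasurableSet.const _
  | @func n f ts ih =>
    have : {M : Str L | @Language.Term.realize L ℕ M.toStructure ℕ v (.func f ts) = k} =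
        ⋃ u : Fin n → ℕ,
          (⋂ i, {M : Str L | @Language.Term.realize L ℕ M.toStructure ℕ v (ts i) = u i}) ∩
            {M : Str L | M.func n f u = k} := by
      ext M
      simp only [Set.mem_ofPred_eq, Set.mem_iUnion, Set.mem_inter_iff, Set.mem_iInter,
        Language.Term.realize]
      constructor
      · intro h
        exact ⟨_, fun i => rfl, h⟩
      · rintro ⟨u, hu, h⟩
        rw [funext hu]
        exact h
    rw [this]
    refine MeasurableSet.iUnion fun u => (MeasurableSet.iInter fun i => ih i _).inter ?_
    exact MeasurableSpace.measurableSet_generateFrom (Or.inl ⟨n, f, u, k, rfl⟩)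

lemma measurableSet_sat (φ : InfForm L) (v : ℕ → ℕ) :
    MeasurableSet {M : Str L | Sat M.toStructure φ v} := by
  induction φ generalizing v with
  | equal t₁ t₂ =>
    have : {M : Str L | Sat M.toStructure (.equal t₁ t₂) v} =
        ⋃ k : ℕ, {M : Str L | @Language.Term.realize L ℕ M.toStructure ℕ v t₁ = k} ∩
          {M : Str L | @Language.Term.realize L ℕ M.toStructure ℕ v t₂ = k} := by
      ext M
      simp only [Sat, Set.mem_ofPred_eq, Set.mem_iUnion, Set.mem_inter_iff]
      exact ⟨fun h => ⟨_, h, rfl⟩, fun ⟨k, h1, h2⟩ => h1.trans h2.symm⟩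
    rw [this]
    exact MeasurableSet.iUnion fun k =>
      (measurableSet_realize t₁ v k).inter (measurableSet_realize t₂ v k)
  | @rel n R ts =>
    have : {M : Str L | Sat M.toStructure (.rel R ts) v} =
        ⋃ u : Fin n → ℕ,
          (⋂ i, {M : Str L | @Language.Term.realize L ℕ M.toStructure ℕ v (ts i) = u i}) ∩
            {M : Str L | M.rel n R u = true} := by
      ext M
      simp only [Set.mem_ofPred_eq, Set.mem_iUnion, Set.mem_inter_iff, Set.mem_iInter, Sat]
      constructor
      · intro h
        exact ⟨_, fun i => rfl, h⟩
      · rintro ⟨u, hu, h⟩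
        rw [funext hu]
        exact h
    rw [this]
    refine MeasurableSet.iUnion fun u =>
      (MeasurableSet.iInter fun i => measurableSet_realize _ v _).inter ?_
    exact MeasurableSpace.measurableSet_generateFrom (Or.inr ⟨n, R, u, rfl⟩)
  | not φ ih => exact (ih v).compl
  | and φ ψ ih₁ ih₂ => exact (ih₁ v).inter (ih₂ v)
  | iand f ih =>
    simp only [Sat, Set.ofPred_forall]
    exact MeasurableSet.iInter fun n => ih n v
  | ex i φ ih =>
    simp only [Sat, Set.ofPred_exists]
    exact MeasurableSet.iUnion fun a => ih _

lemma realize_permStr (g : Equiv.Perm ℕ) (M : Str L) (t : L.Term ℕ) (v : ℕ → ℕ) :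
    @Language.Term.realize L ℕ (permStr g M).toStructure ℕ (g ∘ v) t =
      g (@Language.Term.realize L ℕ M.toStructure ℕ v t) := by
  induction t with
  | var i => rfl
  | @func n f ts ih =>
    change g (M.func n f fun i => g.symm (@Language.Term.realize L ℕ (permStr g M).toStructure ℕ
      (g ∘ v) (ts i))) = g (M.func n f fun i => @Language.Term.realize L ℕ M.toStructure ℕ v (ts i))
    simp only [ih, Equiv.symm_apply_apply]

lemma sat_permStr (g : Equiv.Perm ℕ) (M : Str L) (φ : InfForm L) (v : ℕ → ℕ) :
    Sat (permStr g M).toStructure φ (g ∘ v) ↔ Sat M.toStructure φ v := by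
  induction φ generalizing v with
  | equal t₁ t₂ => simp only [Sat, realize_permStr, g.apply_eq_iff_eq]
  | @rel n R ts =>
    change M.rel n R (fun i => g.symm (@Language.Term.realize L ℕ (permStr g M).toStructure ℕ
      (g ∘ v) (ts i))) = true ↔
      M.rel n R (fun i => @Language.Term.realize L ℕ M.toStructure ℕ v (ts i)) = true
    simp only [realize_permStr, Equiv.symm_apply_apply]
  | not φ ih => exact not_congr (ih v)
  | and φ ψ ih₁ ih₂ => exact and_congr (ih₁ v) (ih₂ v)
  | iand f ih => exact forall_congr' fun n => ih n v
  | ex i φ ih =>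
    refine g.symm.exists_congr fun a => ?_
    rw [← ih, Function.comp_update, Equiv.apply_symm_apply]

lemma measure_unique_eq_zero (μ : Measure (Str L)) [IsProbabilityMeasure μ] (hμ : IsInvariant μ)
    {φ : InfForm L} {k : ℕ} (hφ : freeVars φ ⊆ Set.Iic k) (v : ℕ → ℕ) (b : ℕ)
    (hb : ∀ i < k, v i ≠ b) :
    μ {M : Str L | ∀ c, Sat M.toStructure φ (Function.update v k c) ↔ c = b} = 0 := by
  set E : ℕ → Set (Str L) :=
    fun b => {M : Str L | ∀ c, Sat M.toStructure φ (Function.update v k c) ↔ c = b} with hE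
  have hmeas : ∀ b, MeasurableSet (E b) := by
    intro b
    simp only [hE, Set.ofPred_forall]
    refine MeasurableSet.iInter fun c => ?_
    by_cases h : c = b
    · simpa [h] using measurableSet_sat φ _
    · simp only [h, iff_false]
      exact (measurableSet_sat φ (Function.update v k c)).compl
  have hinv : ∀ b', (∀ i < k, v i ≠ b') → μ (E b') = μ (E b) := by
    intro b' hb'
    set g := Equiv.swap b b'
    have hg : permStr g ⁻¹' E b' = E b := by
      ext M
      simp only [hE, Set.mem_preimage, Set.mem_ofPred_eq]
      refine g.symm.forall_congr fun c => ?_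
      have h1 : Sat (permStr g M).toStructure φ (Function.update v k c) ↔
          Sat (permStr g M).toStructure φ (g ∘ Function.update v k (g.symm c)) := by
        refine sat_congr _ φ fun i hi => ?_
        rcases (Set.mem_Iic.1 (hφ hi)).eq_or_lt with rfl | hi
        · simp
        · simp only [Function.comp, Function.update_of_ne hi.ne]
          exact (Equiv.swap_apply_of_ne_of_ne (hb i hi) (hb' i hi)).symm
      rw [h1, sat_permStr, Equiv.symm_apply_eq]
      simp [g]
    rw [← hg, hμ g _ (hmeas b')]
  by_contra hne
  have hfin := Measure.finite_const_le_meas_of_disjoint_iUnion μ (pos_iff_ne_zero.2 hne) hmeas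
    (As := E) (fun b b' hbb => Set.disjoint_left.2 fun M h1 h2 => hbb <|
      (h2 b).1 ((h1 b).2 rfl)) (measure_ne_top _ _)
  have hinf : {b' : ℕ | ∀ i < k, v i ≠ b'}.Infinite := by
    have : {b' : ℕ | ∀ i < k, v i ≠ b'} = (v '' Set.Iio k)ᶜ := by
      ext b'; simp
    rw [this]
    exact ((Set.finite_Iio k).image v).infinite_compl
  exact hinf (hfin.subset fun b' hb' => (hinv b' hb').ge)

lemma ae_trivial_dcl [Countable (Σ n, L.Functions n)] [Countable (Σ n, L.Relations n)]
    (μ : Measure (Str L)) [IsProbabilityMeasure μ] (hμ : IsInvariant μ) :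
    ∀ᵐ M ∂μ, ∀ φ : InfForm L, IsFirstOrder φ → ∀ k, freeVars φ ⊆ Set.Iic k → ∀ v : ℕ → ℕ,
      (∀ c, Sat M.toStructure φ (Function.update v k c) ↔ c = v k) → ∃ i < k, v i = v k := by
  have key : ∀ᵐ M ∂μ, ∀ φ ∈ {φ : InfForm L | IsFirstOrder φ}, ∀ k, freeVars φ ⊆ Set.Iic k →
      ∀ v : ℕ →₀ ℕ, ∀ b, (∀ i < k, v i ≠ b) →
        ¬ ∀ c, Sat M.toStructure φ (Function.update v k c) ↔ c = b := by
    refine (ae_ball_iff countable_firstOrder).2 fun φ _ => ae_all_iff.2 fun k => ?_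
    by_cases hφ : freeVars φ ⊆ Set.Iic k
    · refine (ae_all_iff.2 fun v : ℕ →₀ ℕ => ae_all_iff.2 fun b => ?_).mono fun M h _ => h
      by_cases hb : ∀ i < k, v i ≠ b
      · have := measure_unique_eq_zero μ hμ hφ v b hb
        filter_upwards [measure_eq_zero_iff_ae_notMem.1 this] with M hM _ using hM
      · exact Filter.Eventually.of_forall fun M h => (hb h).elim
    · exact Filter.Eventually.of_forall fun M h => (hφ h).elim
  filter_upwards [key] with M hM φ hfo k hφ v hv
  by_contra! hcon
  let w : ℕ →₀ ℕ := Finsupp.onFinset (Finset.range k) (fun i => if i < k then v i else 0)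
    fun i hi => by simp only [ne_eq, ite_eq_right_iff, not_forall] at hi; simpa using hi.1
  have hw : ∀ i < k, w i = v i := fun i hi => by simp [w, hi]
  refine hM φ hfo k hφ w (v k) (fun i hi => by rw [hw i hi]; exact hcon i hi) fun c => ?_
  rw [← hv c]
  refine sat_congr _ φ fun i hi => ?_
  rcases (Set.mem_Iic.1 (hφ hi)).eq_or_lt with rfl | hi
  · simp
  · rw [Function.update_of_ne hi.ne, Function.update_of_ne hi.ne, hw i hi]

/-- The first-order theory of a structure. -/
def foTheory {M : Type} (S : L.Structure M) : Set (InfForm L) :=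
  {φ | (IsFirstOrder φ ∧ IsSentence φ) ∧ ∀ v, Sat S φ v}

lemma consequence_foTheory_or {M : Type} [Nonempty M] (S : L.Structure M) {φ : InfForm L}
    (hφ : IsFirstOrder φ) (hs : IsSentence φ) :
    Consequence (foTheory S) φ ∨ Consequence (foTheory S) (.not φ) := by
  by_cases h : ∀ v, Sat S φ v
  · exact Or.inl fun N S' _ hN => hN φ ⟨⟨hφ, hs⟩, h⟩
  · obtain ⟨v, hv⟩ := not_forall.1 h
    exact Or.inr fun N S' _ hN => hN (.not φ) ⟨⟨hφ, hs⟩, fun w => fun hw =>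
      hv ((hs.sat_iff S v w).2 hw)⟩

lemma hasTrivialDcl_foTheory {M : Type} [Nonempty M] (S : L.Structure M)
    (h : ∀ φ : InfForm L, IsFirstOrder φ → ∀ k, freeVars φ ⊆ Set.Iic k → ∀ v : ℕ → M,
      (∀ c, Sat S φ (Function.update v k c) ↔ c = v k) → ∃ i < k, v i = v k) :
    HasTrivialDcl {φ : InfForm L | IsFirstOrder φ} (foTheory S) := by
  rintro N S' _ hN X b ⟨φ, hφ, k, hk, hu, v, hvX, hvb, hv⟩
  set ψ := andNe φ k k
  have hψ : freeVars ψ ⊆ Set.Iio (k + 1) := fun i hi =>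
    Nat.lt_succ_of_le (freeVars_andNe hk k le_rfl hi)
  have hM : ∀ w : ℕ → M, Sat S (.not (exsBelow (k + 1) ψ)) w := by
    intro w hw
    obtain ⟨u, hu'⟩ := (sat_exsBelow_iff S hψ w).1 hw
    obtain ⟨h1, h2⟩ := (sat_andNe S φ k k u).1 hu'
    obtain ⟨c, hc, huniq⟩ := hu M S inferInstance (fun σ hσ => hσ.2) u
    have hcu : u k = c := huniq _ (by simpa using h1)
    obtain ⟨i, hi, hik⟩ := h φ hφ k hk u fun d =>
      ⟨fun hd => (huniq d hd).trans hcu.symm, fun hd => by rw [hd, hcu]; exact hc⟩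
    exact h2 i hi hik
  have hT : InfForm.not (exsBelow (k + 1) ψ) ∈ foTheory S :=
    ⟨⟨isFirstOrder_exsBelow (k + 1) (isFirstOrder_andNe hφ k k), isSentence_exsBelow hψ⟩, hM⟩
  have := hN _ hT v
  by_contra hb
  refine this ((sat_exsBelow_iff S' hψ v).2 ⟨v, (sat_andNe S' φ k k v).2 ⟨hv, fun i hi hik => ?_⟩⟩)
  exact hb (hvb ▸ hik ▸ hvX i hi)

lemma exists_theory_of_measure [Countable (Σ n, L.Functions n)] [Countable (Σ n, L.Relations n)]
    {Sig : Set (InfForm L)} (hfo : ∀ φ ∈ Sig, IsFirstOrder φ ∧ IsSentence φ)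
    (μ : Measure (Str L)) [IsProbabilityMeasure μ] (hμ : IsInvariant μ)
    (hSig : μ (modelSet Sig) = 1) :
    ∃ T : Set (InfForm L), (∀ φ ∈ T, IsFirstOrder φ ∧ IsSentence φ) ∧ Consistent T ∧
      (∀ φ : InfForm L, IsFirstOrder φ → IsSentence φ →
        (Consequence T φ ∨ Consequence T (InfForm.not φ))) ∧
      Sig ⊆ T ∧ HasTrivialDcl {φ : InfForm L | IsFirstOrder φ} T := by
  obtain ⟨M, hM, hdcl⟩ : ∃ M ∈ modelSet Sig, ∀ φ : InfForm L, IsFirstOrder φ → ∀ k,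
      freeVars φ ⊆ Set.Iic k → ∀ v : ℕ → ℕ,
      (∀ c, Sat M.toStructure φ (Function.update v k c) ↔ c = v k) → ∃ i < k, v i = v k := by
    by_contra! hcon
    have h0 := measure_mono_null (t := {M | ¬ _}) (fun M hM => ?_) (ae_iff.1 (ae_trivial_dcl μ hμ))
      (s := modelSet Sig)
    · rw [hSig] at h0
      exact one_ne_zero h0
    · intro h
      obtain ⟨φ, h1, k, h2, v, h3, h4⟩ := hcon M hM
      obtain ⟨i, hi, hik⟩ := h φ h1 k h2 v h3
      exact h4 i hi hik
  exact ⟨foTheory M.toStructure, fun φ hφ => hφ.1,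
    ⟨ℕ, M.toStructure, inferInstance, fun φ hφ => hφ.2⟩,
    fun φ h1 h2 => consequence_foTheory_or _ h1 h2,
    fun φ hφ => ⟨hfo φ hφ, hM φ hφ⟩, hasTrivialDcl_foTheory _ hdcl⟩

/-! ### Duplicating elements in models of a theory with trivial definable closure -/

lemma IsFO.exists_freeVars_subset {M : Type} {S : L.Structure M} {P : (ℕ → M) → Prop}
    (h : IsFO S P) {k : ℕ} (hP : DependsBelow P k) :
    ∃ φ : InfForm L, IsFirstOrder φ ∧ freeVars φ ⊆ Set.Iio k ∧ ∀ v, Sat S φ v ↔ P v := by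
  have key : ∀ m, ∀ φ : InfForm L, IsFirstOrder φ → (∀ v, Sat S φ v ↔ P v) →
      freeVars φ ⊆ Set.Iio (k + m) →
      ∃ φ : InfForm L, IsFirstOrder φ ∧ freeVars φ ⊆ Set.Iio k ∧ ∀ v, Sat S φ v ↔ P v := by
    intro m
    induction m with
    | zero => exact fun φ h1 h2 h3 => ⟨φ, h1, h3, h2⟩
    | succ m ih =>
      intro φ h1 h2 h3
      refine ih (.ex (k + m) φ) h1 (fun v => ?_) fun i hi => ?_
      · have : ∀ a, P (Function.update v (k + m) a) ↔ P v := fun a =>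
          hP _ _ fun i hi => Function.update_of_ne (by omega) _ _
        simp only [Sat, h2, this]
        exact ⟨fun ⟨_, h⟩ => h, fun h => ⟨v 0, h⟩⟩
      · have := h3 hi.1
        have hne : i ≠ k + m := hi.2
        simp only [Set.mem_Iio] at this ⊢
        omega
  obtain ⟨φ, h1, h2⟩ := h
  obtain ⟨m, hm⟩ := (freeVars_finite h1).bddAbove
  refine key (m + 1) φ h1 h2 fun i hi => ?_
  have : i ≤ m := hm hi
  simp only [Set.mem_Iio]
  omega

lemma sat_of_complete {T : Set (InfForm L)}
    (hcomp : ∀ φ : InfForm L, IsFirstOrder φ → IsSentence φ →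
      (Consequence T φ ∨ Consequence T (InfForm.not φ)))
    {M : Type} [Nonempty M] {S : L.Structure M} (hM : IsModel S T) {σ : InfForm L}
    (hσ : IsFirstOrder σ) (hs : IsSentence σ) (v : ℕ → M) (hv : Sat S σ v) : Consequence T σ := by
  rcases hcomp σ hσ hs with h | h
  · exact h
  · exact (h M S inferInstance hM v hv).elim

/-- The first-order predicate `∀ x_i, P`. -/
lemma IsFO.all {M : Type} {S : L.Structure M} {P : (ℕ → M) → Prop} (h : IsFO S P) (i : ℕ) :
    IsFO S fun v => ∀ a, P (Function.update v i a) :=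
  (h.not.ex i).not.congr fun v => by simp

/-- In a complete theory, the unique-witness property of a first-order formula can be checked in a
single model. -/
lemma uniqueY_of_model {T : Set (InfForm L)}
    (hcomp : ∀ φ : InfForm L, IsFirstOrder φ → IsSentence φ →
      (Consequence T φ ∨ Consequence T (InfForm.not φ)))
    {M : Type} [Nonempty M] {S : L.Structure M} (hM : IsModel S T) {φ : InfForm L}
    (hφ : IsFirstOrder φ) {k : ℕ} (hk : freeVars φ ⊆ Set.Iic k)
    (hu : ∀ w : ℕ → M, ∃! b, Sat S φ (Function.update w k b)) : UniqueY T φ k := by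
  set φ' : InfForm L := .ex k (.and (.equal (.var k) (.var (k + 1))) φ) with hφ'
  have hsat' : ∀ {N : Type} (S' : L.Structure N) (v : ℕ → N),
      Sat S' φ' v ↔ Sat S' φ (Function.update v k (v (k + 1))) := by
    intro N S' v
    simp only [hφ', Sat, Language.Term.realize_var, Function.update_self]
    constructor
    · rintro ⟨a, ha, h⟩
      rw [Function.update_of_ne (by omega)] at ha
      rwa [← ha]
    · intro h
      exact ⟨v (k + 1), by rw [Function.update_of_ne (by omega)], h⟩
  set χ : InfForm L := .and (.and φ φ') (.not (.equal (.var k) (.var (k + 1)))) with hχ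
  have hsatχ : ∀ {N : Type} (S' : L.Structure N) (v : ℕ → N), Sat S' χ v ↔
      (Sat S' φ v ∧ Sat S' φ (Function.update v k (v (k + 1)))) ∧ v k ≠ v (k + 1) := by
    intro N S' v
    rw [← hsat']
    rfl
  have hfφ : ∀ i ∈ freeVars φ, i ≤ k := fun i hi => hk hi
  have hχv : freeVars χ ⊆ Set.Iio (k + 2) := by
    intro i hi
    simp only [hχ, hφ', freeVars, termVars, Set.mem_union, Set.mem_sdiff,
      Set.mem_singleton_iff] at hi
    have := hfφ i
    simp only [Set.mem_Iio]
    rcases hi with (hi | ⟨(hi | hi) | hi, _⟩) | hi | hi <;> first | omega | (have := this hi; omega)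
  have hev : freeVars (.not (.ex k φ)) ⊆ Set.Iio k := by
    intro i hi
    have h1 := hfφ i hi.1
    have h2 : i ≠ k := hi.2
    simp only [Set.mem_Iio]
    omega
  have hexists : Consequence T (.not (exsBelow k (.not (.ex k φ)))) := by
    obtain ⟨m₀⟩ := ‹Nonempty M›
    refine sat_of_complete hcomp hM (isFirstOrder_exsBelow k (φ := .not (.ex k φ)) hφ)
      (isSentence_exsBelow hev) (fun _ => m₀) fun h => ?_
    obtain ⟨w, hw⟩ := (sat_exsBelow_iff S hev _).1 h
    obtain ⟨b, hb, _⟩ := hu w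
    exact hw ⟨b, hb⟩
  have hunique : Consequence T (.not (exsBelow (k + 2) χ)) := by
    obtain ⟨m₀⟩ := ‹Nonempty M›
    refine sat_of_complete hcomp hM
      (isFirstOrder_exsBelow (k + 2) (φ := χ) ⟨⟨hφ, trivial, hφ⟩, trivial⟩)
      (isSentence_exsBelow hχv) (fun _ => m₀) fun h => ?_
    obtain ⟨w, hw⟩ := (sat_exsBelow_iff S hχv _).1 h
    obtain ⟨⟨h1, h2⟩, h3⟩ := (hsatχ S w).1 hw
    exact h3 ((hu w).unique (by simpa using h1) h2)
  intro N S' hne hN w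
  have h1 := hexists N S' hne hN w
  have h2 := hunique N S' hne hN w
  simp only [Sat, sat_exsBelow_iff S' hev, sat_exsBelow_iff S' hχv, hsatχ] at h1 h2
  push Not at h1 h2
  obtain ⟨b, hb⟩ := h1 w
  refine ⟨b, hb, fun c hc => ?_⟩
  by_contra hcb
  have h3 := h2 (Function.update (Function.update w (k + 1) b) k c)
    ⟨(sat_congr S' φ fun i hi => ?_).1 hc, (sat_congr S' φ fun i hi => ?_).1 hb⟩
  · rw [Function.update_self, Function.update_of_ne (by omega), Function.update_self] at h3
    exact hcb h3
  all_goals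
    have := hfφ i hi
    by_cases hik : i = k
    · subst hik; simp
    · simp only [Function.update_of_ne hik, Function.update_of_ne (show i ≠ k + 1 by omega)]

/-- Elements that are first-order definable over parameters in `M` are among the parameters. -/
def TrivialDclIn {M : Type} (S : L.Structure M) : Prop :=
  ∀ P : (ℕ → M) → Prop, IsFO S P → ∀ k, DependsBelow P (k + 1) → ∀ v : ℕ → M,
    (∀ c, P (Function.update v k c) ↔ c = v k) → ∃ i < k, v i = v k

lemma HasTrivialDcl.trivialDclIn {T : Set (InfForm L)}
    (hcomp : ∀ φ : InfForm L, IsFirstOrder φ → IsSentence φ →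
      (Consequence T φ ∨ Consequence T (InfForm.not φ)))
    (hdcl : HasTrivialDcl {φ : InfForm L | IsFirstOrder φ} T)
    {M : Type} [Nonempty M] {S : L.Structure M} (hM : IsModel S T) : TrivialDclIn S := by
  intro P hP k hk v hv
  let U : (ℕ → M) → Prop := fun w => ∃ a, ∀ c, P (Function.update w k c) ↔ c = a
  have hU : IsFO S U := by
    have h1 := ((hP.and (IsFO.eq S k (k + 1))).or (hP.not.and (IsFO.eq S k (k + 1)).not))
    refine ((h1.all k).ex (k + 1)).congr fun w => exists_congr fun a => forall_congr' fun c => ?_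
    have hPw : P (Function.update (Function.update w (k + 1) a) k c) ↔ P (Function.update w k c) := by
      refine hk _ _ fun i hi => ?_
      by_cases hik : i = k
      · subst hik; simp
      · simp only [Function.update_of_ne hik, Function.update_of_ne (show i ≠ k + 1 by omega)]
    rw [hPw, Function.update_self, Function.update_of_ne (by omega), Function.update_self]
    tauto
  let Q : (ℕ → M) → Prop := fun w => (U w ∧ P w) ∨ (¬ U w ∧ w k = w 0)
  have hQ : IsFO S Q := (hU.and hP).or (hU.not.and (IsFO.eq S k 0))
  have hUcongr : ∀ w w' : ℕ → M, (∀ i < k, w i = w' i) → (U w ↔ U w') := fun w w' h =>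
    exists_congr fun a => forall_congr' fun c => by
      rw [hk (Function.update w k c) (Function.update w' k c) fun i hi => ?_]
      by_cases hik : i = k
      · subst hik; simp
      · simp only [Function.update_of_ne hik, h i (by omega)]
  have hQk : DependsBelow Q (k + 1) := fun w w' h => by
    simp only [Q, hUcongr w w' fun i hi => h i (by omega), hk w w' h, h k (by omega),
      h 0 (by omega)]
  have hUv : U v := ⟨v k, hv⟩
  have hQu : ∀ w : ℕ → M, ∃! b, Q (Function.update w k b) := by
    intro w
    have hUw : ∀ b, U (Function.update w k b) ↔ U w := fun b =>
      hUcongr _ _ fun i hi => Function.update_of_ne hi.ne _ _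
    by_cases hw : U w
    · obtain ⟨a, ha⟩ := hw
      have hw : U w := ⟨a, ha⟩
      refine ⟨a, Or.inl ⟨(hUw a).2 hw, (ha a).2 rfl⟩, fun c hc => ?_⟩
      rcases hc with hc | hc
      · exact (ha c).1 hc.2
      · exact (hc.1 ((hUw c).2 hw)).elim
    · have hk0 : (0 : ℕ) ≠ k := by
        rintro rfl
        exact hw ((hUcongr v w fun i hi => by omega).1 hUv)
      refine ⟨w 0, Or.inr ⟨(hUw _).not.2 hw, ?_⟩, fun c hc => ?_⟩
      · rw [Function.update_self, Function.update_of_ne hk0]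
      · rcases hc with hc | hc
        · exact (hw ((hUw c).1 hc.1)).elim
        · have := hc.2
          rwa [Function.update_self, Function.update_of_ne hk0] at this
  obtain ⟨φ, hφ, hφk, hφQ⟩ := hQ.exists_freeVars_subset hQk
  have hφk' : freeVars φ ⊆ Set.Iic k := fun i hi => Nat.lt_succ_iff.1 (hφk hi)
  have hPv : P v := by simpa using (hv (v k)).2 rfl
  have := hdcl M S inferInstance hM (v '' Set.Iio k) (v k)
    ⟨φ, hφ, k, hφk', uniqueY_of_model hcomp hM hφ hφk' (by simpa only [hφQ] using hQu), v,
      fun i hi => ⟨i, hi, rfl⟩, rfl, (hφQ v).2 (Or.inl ⟨hUv, hPv⟩)⟩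
  simpa using this

lemma exists_enum_finite {M : Type} [Nonempty M] {s : Set M} (hs : s.Finite) :
    ∃ (m : ℕ) (f : ℕ → M), s = f '' Set.Iio m := by
  obtain ⟨m, f, hf⟩ := hs.fin_embedding
  obtain ⟨m₀⟩ := ‹Nonempty M›
  refine ⟨m, fun i => if h : i < m then f ⟨i, h⟩ else m₀, ?_⟩
  rw [← hf]
  ext x
  simp only [Set.mem_range, Set.mem_image, Set.mem_Iio]
  constructor
  · rintro ⟨i, rfl⟩
    exact ⟨i, i.2, by simp⟩
  · rintro ⟨i, hi, rfl⟩
    exact ⟨⟨i, hi⟩, by simp [hi]⟩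

lemma TrivialDclIn.infinite {M : Type} {S : L.Structure M} (hS : TrivialDclIn S)
    {P : (ℕ → M) → Prop} (hP : IsFO S P) {k : ℕ} (hk : DependsBelow P (k + 1)) {v : ℕ → M}
    (hv : P v) (hne : ∀ i < k, v i ≠ v k) : {c | P (Function.update v k c)}.Infinite := by
  intro hfin
  have : Nonempty M := ⟨v 0⟩
  have hfin' : ({c | P (Function.update v k c)} \ {v k}).Finite := hfin.subset Set.sdiff_subset
  obtain ⟨m, f, hf⟩ := exists_enum_finite hfin'
  have hfm : ∀ c, (P (Function.update v k c) ∧ c ≠ v k) ↔ ∃ i < m, f i = c := fun c =>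
    Set.ext_iff.1 hf c
  let v' : ℕ → M := fun i => if i < k then v i else if i < k + m then f (i - k) else v k
  have hv'1 : ∀ i < k, v' i = v i := fun i hi => if_pos hi
  have hv'2 : ∀ i < m, v' (k + i) = f i := fun i hi => by simp [v', hi]
  have hv'3 : v' (k + m) = v k := by simp [v']
  let σ : ℕ → ℕ := fun i => if i < k then i else k + m
  let P₀ : (ℕ → M) → Prop := fun w => P (w ∘ σ) ∧ ∀ i ∈ Set.Iio m, ¬ w (k + i) = w (k + m)
  have hP₀ : IsFO S P₀ :=
    (hP.rename σ).and (IsFO.all_mem (Set.finite_Iio m) fun i _ => (IsFO.eq S (k + i) (k + m)).not)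
  have hdep : DependsBelow P₀ (k + m + 1) := fun w w' h => by
    refine and_congr (hk _ _ fun i hi => ?_) (forall₂_congr fun i hi => ?_)
    · simp only [Function.comp, σ]
      split_ifs with h1
      · exact h _ (by omega)
      · exact h _ (by omega)
    · rw [h (k + i) (by simp only [Set.mem_Iio] at hi; omega), h (k + m) (by omega)]
  obtain ⟨i, hi, hik⟩ := hS P₀ hP₀ (k + m) hdep v' fun c => by
    have h1 : P (Function.update v' (k + m) c ∘ σ) ↔ P (Function.update v k c) := by
      refine hk _ _ fun i hi => ?_
      simp only [Function.comp, σ]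
      split_ifs with h1
      · rw [Function.update_of_ne (by omega), Function.update_of_ne (by omega), hv'1 i h1]
      · obtain rfl : i = k := by omega
        simp
    have h2 : (∀ i ∈ Set.Iio m, ¬ Function.update v' (k + m) c (k + i) =
        Function.update v' (k + m) c (k + m)) ↔ ∀ i < m, f i ≠ c := by
      refine forall₂_congr fun i hi => ?_
      simp only [Set.mem_Iio] at hi
      rw [Function.update_self, Function.update_of_ne (by omega), hv'2 i hi]
    simp only [P₀]
    rw [h1, h2, hv'3]
    have h3 := hfm c
    constructor
    · rintro ⟨h4, h5⟩
      by_contra hc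
      obtain ⟨i, hi, hic⟩ := h3.1 ⟨h4, hc⟩
      exact h5 i hi hic
    · rintro rfl
      exact ⟨by simpa using hv, fun i hi hic => (h3.2 ⟨i, hi, hic⟩).2 rfl⟩
  rw [hv'3] at hik
  by_cases h1 : i < k
  · exact hne i h1 (by rwa [hv'1 i h1] at hik)
  · obtain ⟨j, rfl⟩ := Nat.exists_eq_add_of_le (not_lt.1 h1)
    rw [hv'2 j (by omega)] at hik
    exact ((hfm (v k)).2 ⟨j, by omega, hik⟩).2 rfl

lemma exists_freeVars_bound {Δ : Set (InfForm L)} (hΔ : Δ.Finite)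
    (hfo : ∀ φ ∈ Δ, IsFirstOrder φ) : ∃ m, ∀ φ ∈ Δ, ∀ i ∈ freeVars φ, i < m := by
  obtain ⟨m, hm⟩ := (hΔ.biUnion fun φ hφ => freeVars_finite (hfo φ hφ)).bddAbove
  exact ⟨m + 1, fun φ hφ i hi => Nat.lt_succ_of_le (hm (Set.mem_biUnion hφ hi))⟩

lemma finite_setOf_eventually_const {α : Type*} {s : Set α} (hs : s.Finite) (a : α) (m : ℕ) :
    {u : ℕ → α | (∀ i < m, u i ∈ s) ∧ ∀ i, m ≤ i → u i = a}.Finite := by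
  have := hs.to_subtype
  refine (Set.finite_range fun (g : Fin m → s) (i : ℕ) => if h : i < m then (g ⟨i, h⟩ : α) else a).subset
    fun u hu => ⟨fun i => ⟨u i, hu.1 i i.2⟩, funext fun i => ?_⟩
  by_cases h : i < m
  · simp [h]
  · simp [h, hu.2 i (not_lt.1 h)]

open Classical in
/-- An element of a finite set can be replaced by a fresh one without changing the truth values of
finitely many formulas. -/
lemma TrivialDclIn.exists_duplicate {M : Type} {S : L.Structure M} (hS : TrivialDclIn S)
    {Δ : Set (InfForm L)} (hΔ : Δ.Finite) (hfo : ∀ φ ∈ Δ, IsFirstOrder φ)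
    {A : Set M} (hA : A.Finite) (a : M) :
    ∃ a' ∉ A, ∀ φ ∈ Δ, ∀ u : ℕ → M, (∀ i, u i ∈ A) →
      (Sat S φ (Function.update id a a' ∘ u) ↔ Sat S φ u) := by
  have : Nonempty M := ⟨a⟩
  obtain ⟨m, hm⟩ := exists_freeVars_bound hΔ hfo
  have hAa : (A \ {a}).Finite := hA.subset Set.sdiff_subset
  obtain ⟨k, f, hf⟩ := exists_enum_finite hAa
  have hfk : ∀ c, (c ∈ A ∧ c ≠ a) ↔ ∃ i < k, f i = c := fun c => Set.ext_iff.1 hf c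
  let v : ℕ → M := fun i => if i < k then f i else a
  have hvk : v k = a := by simp [v]
  have hvlt : ∀ i < k, v i = f i := fun i hi => if_pos hi
  have hvne : ∀ i < k, v i ≠ a := fun i hi => by
    rw [hvlt i hi]
    exact ((hfk (f i)).2 ⟨i, hi, rfl⟩).2
  let Sg : Set (ℕ → ℕ) := {σ | (∀ i < m, σ i ∈ Set.Iic k) ∧ ∀ i, m ≤ i → σ i = 0}
  have hSg : Sg.Finite := finite_setOf_eventually_const (Set.finite_Iic k) 0 m
  let P : (ℕ → M) → Prop := fun w => ∀ p ∈ Δ ×ˢ Sg, (Sat S p.1 (w ∘ p.2) ↔ Sat S p.1 (v ∘ p.2))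
  have hP : IsFO S P := by
    refine IsFO.all_mem (hΔ.prod hSg) fun p hp => ?_
    have h1 := (isFO_sat S (hfo _ hp.1)).rename p.2
    by_cases h2 : Sat S p.1 (v ∘ p.2)
    · exact h1.congr fun w => by simp [h2]
    · exact h1.not.congr fun w => by simp [h2]
  have hdep : DependsBelow P (k + 1) := by
    refine fun w w' h => forall₂_congr fun p hp => ?_
    rw [sat_congr S p.1 fun i hi => ?_]
    exact h _ (Nat.lt_succ_of_le (hp.2.1 i (hm _ hp.1 i hi)))
  obtain ⟨a', ha', hA'⟩ := (hS.infinite hP hdep (v := v) (fun p _ => Iff.rfl)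
    (fun i hi => hvk ▸ hvne i hi)).exists_notMem_finite hA
  refine ⟨a', hA', fun φ hφ u hu => ?_⟩
  have hσ : ∀ i, ∃ j ≤ k, v j = u i := by
    intro i
    by_cases hui : u i = a
    · exact ⟨k, le_rfl, hvk.trans hui.symm⟩
    · obtain ⟨j, hj, hji⟩ := (hfk (u i)).1 ⟨hu i, hui⟩
      exact ⟨j, hj.le, (hvlt j hj).trans hji⟩
  choose σ hσk hσu using hσ
  have hmem : (φ, fun i => if i < m then σ i else 0) ∈ Δ ×ˢ Sg :=
    ⟨hφ, fun i hi => by simpa [hi] using hσk i, fun i hi => by simp [hi]⟩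
  have key := ha' _ hmem
  refine Iff.trans (sat_congr S φ fun i hi => ?_) (key.trans (sat_congr S φ fun i hi => ?_))
  · simp only [Function.comp, if_pos (hm φ hφ i hi)]
    by_cases hk : σ i = k
    · have : u i = a := by rw [← hσu, hk, hvk]
      rw [this, hk, Function.update_self, Function.update_self]
    · have : u i ≠ a := by
        rw [← hσu]
        exact hvne _ (lt_of_le_of_ne (hσk i) hk)
      rw [Function.update_of_ne this, Function.update_of_ne hk, hσu]
      rfl
  · simp only [Function.comp, if_pos (hm φ hφ i hi), hσu]

/-- Replace the elements of `s` by their images under `d`. -/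
noncomputable def replaceOn {M : Type} (s : Set M) (d : M → M) (x : M) : M :=
  open Classical in if x ∈ s then d x else x

open Classical in
/-- All elements of a finite set can be duplicated simultaneously. -/
lemma TrivialDclIn.exists_duplication {M : Type} {S : L.Structure M} (hS : TrivialDclIn S)
    {Δ : Set (InfForm L)} (hΔ : Δ.Finite) (hfo : ∀ φ ∈ Δ, IsFirstOrder φ)
    {A : Set M} (hA : A.Finite) :
    ∃ d : M → M, Set.InjOn d A ∧ (∀ a ∈ A, d a ∉ A) ∧ ∀ s ⊆ A, ∀ φ ∈ Δ, ∀ u : ℕ → M,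
      (∀ i, u i ∈ A) → (Sat S φ (replaceOn s d ∘ u) ↔ Sat S φ u) := by
  suffices h : ∀ B : Set M, B.Finite → B ⊆ A → ∃ d : M → M, Set.InjOn d B ∧ (∀ a ∈ B, d a ∉ A) ∧
      ∀ s ⊆ B, ∀ φ ∈ Δ, ∀ u : ℕ → M,
        (∀ i, u i ∈ A) → (Sat S φ (replaceOn s d ∘ u) ↔ Sat S φ u) from h A hA subset_rfl
  intro B hB
  induction B, hB using Set.Finite.induction_on with
  | empty =>
    refine fun _ => ⟨id, by simp, by simp, fun s hs φ _ u _ => ?_⟩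
    have : replaceOn s id ∘ u = u := by funext i; simp [replaceOn]
    rw [this]
  | @insert a B ha hB ih =>
    intro hBA
    obtain ⟨d, hd1, hd2, hd3⟩ := ih ((Set.subset_insert _ _).trans hBA)
    obtain ⟨a', ha'1, ha'2⟩ := hS.exists_duplicate hΔ hfo (hA.union (hB.image d)) a
    have haA : a ∈ A := hBA (Set.mem_insert _ _)
    have hne : ∀ b ∈ B, b ≠ a := fun b hb h => ha (h ▸ hb)
    have hupd : ∀ b ∈ B, Function.update d a a' b = d b := fun b hb =>
      Function.update_of_ne (hne b hb) _ _
    refine ⟨Function.update d a a', ?_, ?_, ?_⟩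
    · rw [Set.injOn_insert ha]
      refine ⟨fun x hx y hy hxy => hd1 hx hy (by rwa [hupd x hx, hupd y hy] at hxy), ?_⟩
      rintro ⟨b, hb, hba⟩
      rw [hupd b hb, Function.update_self] at hba
      exact ha'1 (Or.inr ⟨b, hb, hba⟩)
    · rintro b (rfl | hb)
      · rw [Function.update_self]
        exact fun h => ha'1 (Or.inl h)
      · rw [hupd b hb]
        exact hd2 b hb
    · intro s hs φ hφ u hu
      have hsB : s \ {a} ⊆ B := fun x hx => (hs hx.1).resolve_left hx.2
      rw [← hd3 (s \ {a}) hsB φ hφ u hu]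
      have hx : ∀ x ∈ A, x ≠ a → replaceOn (s \ {a}) d x ≠ a ∧
          replaceOn s (Function.update d a a') x = replaceOn (s \ {a}) d x := by
        intro x hxA hxa
        by_cases hxs : x ∈ s
        · have hxB : x ∈ B := hsB ⟨hxs, hxa⟩
          simp only [replaceOn, Set.mem_sdiff, hxs, Set.mem_singleton_iff, hxa, not_false_eq_true,
            and_self, if_true, hupd x hxB, and_true]
          exact fun h => hd2 x hxB (h ▸ haA)
        · simp [replaceOn, hxs, hxa]
      have hmem : ∀ i, (replaceOn (s \ {a}) d ∘ u) i ∈ A ∪ d '' B := by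
        intro i
        simp only [Function.comp, replaceOn]
        split_ifs with h
        · exact Or.inr ⟨_, hsB h, rfl⟩
        · exact Or.inl (hu i)
      by_cases has : a ∈ s
      · rw [← ha'2 φ hφ _ hmem]
        refine sat_congr S φ fun i _ => ?_
        by_cases hi : u i = a
        · simp [hi, replaceOn, has]
        · obtain ⟨h1, h2⟩ := hx (u i) (hu i) hi
          simp only [Function.comp, h2, Function.update_of_ne h1, id]
      · refine sat_congr S φ fun i _ => ?_
        by_cases hi : u i = a
        · simp [hi, replaceOn, has]
        · exact (hx (u i) (hu i) hi).2

/-- A finite set can be enlarged to a finite set containing witnesses for finitely many existential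
formulas. -/
lemma exists_witnesses {M : Type} (S : L.Structure M) {Δ : Set (InfForm L)} (hΔ : Δ.Finite)
    (hfo : ∀ φ ∈ Δ, IsFirstOrder φ) {A : Set M} (hA : A.Finite) (hne : A.Nonempty) :
    ∃ A' : Set M, A'.Finite ∧ A ⊆ A' ∧ ∀ φ ∈ Δ, ∀ (i : ℕ) (u : ℕ → M), (∀ j, u j ∈ A) →
      (∃ a, Sat S φ (Function.update u i a)) → ∃ a ∈ A', Sat S φ (Function.update u i a) := by
  obtain ⟨a₀, ha₀⟩ := hne
  obtain ⟨m, hm⟩ := exists_freeVars_bound hΔ hfo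
  have hfin := hΔ.prod ((Set.finite_Iio m).prod (finite_setOf_eventually_const hA a₀ m))
  have : ∀ p : InfForm L × ℕ × (ℕ → M), ∃ a, (∃ a, Sat S p.1 (Function.update p.2.2 p.2.1 a)) →
      Sat S p.1 (Function.update p.2.2 p.2.1 a) := by
    intro p
    by_cases h : ∃ a, Sat S p.1 (Function.update p.2.2 p.2.1 a)
    · obtain ⟨a, ha⟩ := h
      exact ⟨a, fun _ => ha⟩
    · exact ⟨a₀, fun h' => (h h').elim⟩
  choose W hW using this
  refine ⟨A ∪ W '' (Δ ×ˢ Set.Iio m ×ˢ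
    {u | (∀ i < m, u i ∈ A) ∧ ∀ i, m ≤ i → u i = a₀}), hA.union (hfin.image W), Set.subset_union_left, ?_⟩
  rintro φ hφ i u hu ⟨a, ha⟩
  by_cases hi : i < m
  · let u' : ℕ → M := fun j => if j < m then u j else a₀
    have hcongr : ∀ b, Sat S φ (Function.update u' i b) ↔ Sat S φ (Function.update u i b) := by
      refine fun b => sat_congr S φ fun j hj => ?_
      by_cases hji : j = i
      · subst hji; simp
      · simp [Function.update_of_ne hji, u', hm φ hφ j hj]
    refine ⟨W (φ, i, u'), Or.inr ⟨(φ, i, u'), ⟨hφ, hi, fun j hj => ?_, fun j hj => ?_⟩, rfl⟩, ?_⟩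
    · simpa [u', hj] using hu j
    · simp [u', not_lt.2 hj]
    · exact (hcongr _).1 (hW (φ, i, u') ⟨a, (hcongr a).2 ha⟩)
  · refine ⟨a₀, Or.inl ha₀, (sat_congr S φ fun j hj => ?_).1 ha⟩
    have := hm φ hφ j hj
    rw [Function.update_of_ne (by omega), Function.update_of_ne (by omega)]

/-! ### Towers of finite subsets of a model -/

/-- An increasing sequence of finite subsets of a model, each of them containing a duplicate of the
previous one together with witnesses for more and more formulas. -/
structure Tower {M : Type} (S : L.Structure M) where
  /-- The formulas taken care of at each stage. -/
  forms : ℕ → Set (InfForm L)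
  /-- The finite sets. -/
  carrier : ℕ → Set M
  /-- The duplication maps. -/
  dup : ℕ → M → M
  /-- Enumerations of the finite sets. -/
  enum : ℕ → ℕ → M
  /-- The starting point. -/
  base : M
  forms_mono : Monotone forms
  exists_mem_forms : ∀ φ, IsFirstOrder φ → ∃ n, φ ∈ forms n
  base_mem : base ∈ carrier 0
  carrier_subset : ∀ n, carrier n ⊆ carrier (n + 1)
  dup_mem : ∀ n, ∀ a ∈ carrier n, dup n a ∈ carrier (n + 1)
  dup_injOn : ∀ n, Set.InjOn (dup n) (carrier n)
  dup_notMem : ∀ n, ∀ a ∈ carrier n, dup n a ∉ carrier n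
  sat_replaceOn : ∀ n, ∀ s ⊆ carrier n, ∀ φ ∈ forms n, ∀ u : ℕ → M, (∀ i, u i ∈ carrier n) →
    (Sat S φ (replaceOn s (dup n) ∘ u) ↔ Sat S φ u)
  exists_witness : ∀ n, ∀ φ ∈ forms n, ∀ (i : ℕ) (u : ℕ → M),
    (∀ j, u j ∈ carrier n ∪ dup n '' carrier n) → (∃ a, Sat S φ (Function.update u i a)) →
      ∃ a ∈ carrier (n + 1), Sat S φ (Function.update u i a)
  range_enum : ∀ n, Set.range (enum n) = carrier n

lemma TrivialDclIn.nonempty_tower [Countable (Σ n, L.Functions n)] [Countable (Σ n, L.Relations n)]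
    {M : Type} [Nonempty M] {S : L.Structure M} (hS : TrivialDclIn S) : Nonempty (Tower S) := by
  obtain ⟨m₀⟩ := ‹Nonempty M›
  obtain ⟨θ, hθ⟩ := (countable_firstOrder (L := L)).exists_eq_range
    ⟨.equal (.var 0) (.var 0), trivial⟩
  have hθ' : ∀ φ, IsFirstOrder φ ↔ ∃ k, θ k = φ := fun φ => Set.ext_iff.1 hθ φ
  let Δ : ℕ → Set (InfForm L) := fun n => θ '' Set.Iic n
  have hΔ : ∀ n, (Δ n).Finite := fun n => (Set.finite_Iic n).image θ
  have hfo : ∀ n, ∀ φ ∈ Δ n, IsFirstOrder φ := by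
    rintro n _ ⟨k, _, rfl⟩
    exact (hθ' _).2 ⟨k, rfl⟩
  have step : ∀ (n : ℕ) (A : {A : Set M // A.Finite ∧ A.Nonempty}),
      ∃ (A' : {A : Set M // A.Finite ∧ A.Nonempty}) (d : M → M), A.1 ∪ d '' A.1 ⊆ A'.1 ∧
        Set.InjOn d A.1 ∧ (∀ a ∈ A.1, d a ∉ A.1) ∧
        (∀ s ⊆ A.1, ∀ φ ∈ Δ n, ∀ u : ℕ → M, (∀ i, u i ∈ A.1) →
          (Sat S φ (replaceOn s d ∘ u) ↔ Sat S φ u)) ∧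
        ∀ φ ∈ Δ n, ∀ (i : ℕ) (u : ℕ → M), (∀ j, u j ∈ A.1 ∪ d '' A.1) →
          (∃ a, Sat S φ (Function.update u i a)) → ∃ a ∈ A'.1, Sat S φ (Function.update u i a) := by
    rintro n ⟨A, hA, hne⟩
    obtain ⟨d, h1, h2, h3⟩ := hS.exists_duplication (hΔ n) (hfo n) hA
    obtain ⟨A', hA', h4, h5⟩ := exists_witnesses S (hΔ n) (hfo n) (hA.union (hA.image d)) hne.inl
    exact ⟨⟨A', hA', (hne.inl).mono h4⟩, d, h4, h1, h2, h3, h5⟩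
  choose next d h1 h2 h3 h4 h5 using step
  let A : ℕ → {A : Set M // A.Finite ∧ A.Nonempty} := fun n =>
    Nat.rec ⟨{m₀}, Set.finite_singleton m₀, Set.singleton_nonempty m₀⟩ next n
  have henum : ∀ n, ∃ e : ℕ → M, (A n).1 = Set.range e := fun n =>
    (A n).2.1.countable.exists_eq_range (A n).2.2
  choose e he using henum
  exact ⟨{
    forms := Δ
    carrier := fun n => (A n).1
    dup := fun n => d n (A n)
    enum := e
    base := m₀
    forms_mono := fun m n hmn => Set.image_mono (Set.Iic_subset_Iic.2 hmn)
    exists_mem_forms := fun φ hφ => by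
      obtain ⟨k, hk⟩ := (hθ' φ).1 hφ
      exact ⟨k, k, Set.mem_Iic.2 le_rfl, hk⟩
    base_mem := rfl
    carrier_subset := fun n => Set.subset_union_left.trans (h1 n (A n))
    dup_mem := fun n a ha => h1 n (A n) (Or.inr ⟨a, ha, rfl⟩)
    dup_injOn := fun n => h2 n (A n)
    dup_notMem := fun n => h3 n (A n)
    sat_replaceOn := fun n => h4 n (A n)
    exists_witness := fun n => h5 n (A n)
    range_enum := fun n => (he n).symm }⟩

namespace Tower

variable {M : Type} {S : L.Structure M} (W : Tower S)

/-- The path through the tower determined by a sequence of instructions: stay (`0`), duplicate (`1`),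
or jump (`t + 2`). -/
def path (r : ℕ → ℕ) : ℕ → M
  | 0 => W.base
  | n + 1 => match r n with
    | 0 => path r n
    | 1 => W.dup n (path r n)
    | t + 2 => W.enum (n + 1) t

lemma path_mem (r : ℕ → ℕ) (n : ℕ) : W.path r n ∈ W.carrier n := by
  induction n with
  | zero => exact W.base_mem
  | succ n ih =>
    simp only [path]
    split
    · exact W.carrier_subset n ih
    · exact W.dup_mem n _ ih
    · exact W.range_enum (n + 1) ▸ Set.mem_range_self _

lemma path_succ_of_lt {r : ℕ → ℕ} {n : ℕ} (h : r n < 2) :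
    W.path r (n + 1) = if r n = 1 then W.dup n (W.path r n) else W.path r n := by
  obtain h | h : r n = 0 ∨ r n = 1 := by omega
  · simp [path, h]
  · simp [path, h]

lemma path_succ_of_jump {r : ℕ → ℕ} {n t : ℕ} (h : r n = t + 2) :
    W.path r (n + 1) = W.enum (n + 1) t := by
  simp [path, h]

lemma path_congr {r r' : ℕ → ℕ} {n : ℕ} (h : ∀ m < n, r m = r' m) : W.path r n = W.path r' n := by
  induction n with
  | zero => rfl
  | succ n ih => simp only [path, h n n.lt_succ_self, ih fun m hm => h m (hm.trans n.lt_succ_self)]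

lemma path_succ_mem {r : ℕ → ℕ} {n : ℕ} (h : r n < 2) :
    W.path r (n + 1) ∈ W.carrier n ∪ W.dup n '' W.carrier n := by
  rw [W.path_succ_of_lt h]
  split_ifs
  · exact Or.inr ⟨_, W.path_mem r n, rfl⟩
  · exact Or.inl (W.path_mem r n)

section Paths

variable {ω : ℕ → ℕ → ℕ} {I : Set ℕ} {n₀ : ℕ}

lemma path_injOn_succ {n : ℕ} (hI : ∀ i ∈ I, ω i n < 2)
    (hinj : I.InjOn fun i => W.path (ω i) n) : I.InjOn fun i => W.path (ω i) (n + 1) := by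
  intro i hi j hj hij
  have h1 := W.path_mem (ω i) n
  have h2 := W.path_mem (ω j) n
  simp only [W.path_succ_of_lt (hI i hi), W.path_succ_of_lt (hI j hj)] at hij
  apply hinj hi hj
  split_ifs at hij
  · exact W.dup_injOn n h1 h2 hij
  · exact (W.dup_notMem n _ h1 (hij ▸ h2)).elim
  · exact (W.dup_notMem n _ h2 (hij ▸ h1)).elim
  · exact hij

lemma path_injOn (hI : ∀ i ∈ I, ∀ n ≥ n₀, ω i n < 2) (hinj : I.InjOn fun i => W.path (ω i) n₀)
    {n : ℕ} (hn : n₀ ≤ n) : I.InjOn fun i => W.path (ω i) n := by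
  induction n, hn using Nat.le_induction with
  | base => exact hinj
  | succ n hn ih => exact W.path_injOn_succ (fun i hi => hI i hi n hn) ih

lemma sat_path_succ {n : ℕ} (hI : ∀ i ∈ I, ω i n < 2) (hinj : I.InjOn fun i => W.path (ω i) n)
    {φ : InfForm L} (hφ : φ ∈ W.forms n) {v : ℕ → ℕ} (hv : ∀ i ∈ freeVars φ, v i ∈ I) :
    Sat S φ (fun i => W.path (ω (v i)) (n + 1)) ↔ Sat S φ (fun i => W.path (ω (v i)) n) := by
  have hs : (fun i => W.path (ω i) n) '' {i ∈ I | ω i n = 1} ⊆ W.carrier n := by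
    rintro _ ⟨i, _, rfl⟩
    exact W.path_mem _ _
  rw [← W.sat_replaceOn n _ hs φ hφ (fun i => W.path (ω (v i)) n) fun i => W.path_mem _ _]
  refine sat_congr S φ fun i hi => ?_
  rw [W.path_succ_of_lt (hI _ (hv i hi))]
  simp only [replaceOn, Function.comp]
  by_cases h : ω (v i) n = 1
  · rw [if_pos h, if_pos ⟨v i, ⟨hv i hi, h⟩, rfl⟩]
  · rw [if_neg h, if_neg]
    rintro ⟨j, ⟨hj, hj1⟩, hji⟩
    exact h (hinj hj (hv i hi) hji ▸ hj1)

lemma sat_path (hI : ∀ i ∈ I, ∀ n ≥ n₀, ω i n < 2) (hinj : I.InjOn fun i => W.path (ω i) n₀)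
    {φ : InfForm L} (hφ : φ ∈ W.forms n₀) {v : ℕ → ℕ} (hv : ∀ i ∈ freeVars φ, v i ∈ I)
    {n : ℕ} (hn : n₀ ≤ n) :
    Sat S φ (fun i => W.path (ω (v i)) n) ↔ Sat S φ (fun i => W.path (ω (v i)) n₀) := by
  induction n, hn using Nat.le_induction with
  | base => rfl
  | succ n hn ih =>
    exact (W.sat_path_succ (fun i hi => hI i hi n hn) (W.path_injOn hI hinj hn)
      (W.forms_mono hn hφ) hv).trans ih

end Paths

end Tower

open Filter

/-- Instructions for countably many paths that jump only finitely often, separate from each other and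
visit every point of the tower. -/
structure IsGood (ω : ℕ → ℕ → ℕ) : Prop where
  eventually_lt : ∀ i, ∀ᶠ n in atTop, ω i n < 2
  frequently_ne : ∀ i j, i ≠ j → ∃ᶠ n in atTop, ¬ (ω i n = 1 ↔ ω j n = 1)
  exists_jump : ∀ n t, ∃ i, ω i n = t + 2 ∧ ∀ m > n, ω i m < 2

/-- Countably many sequences in a structure whose first-order type converges to a complete type of
pairwise distinct elements forming an elementary substructure. -/
structure IsGeneric {M : Type} (S : L.Structure M) (F : ℕ → ℕ → M) : Prop where
  eventually_ne : ∀ i j, i ≠ j → ∀ᶠ n in atTop, F i n ≠ F j n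
  decides : ∀ φ, IsFirstOrder φ → ∀ v : ℕ → ℕ, (∀ᶠ n in atTop, Sat S φ fun i => F (v i) n) ∨
    ∀ᶠ n in atTop, ¬ Sat S φ fun i => F (v i) n
  exists_witness : ∀ φ, IsFirstOrder φ → ∀ (i : ℕ) (v : ℕ → ℕ),
    (∀ᶠ n in atTop, ∃ a, Sat S φ (Function.update (fun i => F (v i) n) i a)) →
      ∃ j, ∀ᶠ n in atTop, Sat S φ fun k => F (Function.update v i j k) n

open Classical in
lemma IsGood.isGeneric {M : Type} {S : L.Structure M} (W : Tower S) {ω : ℕ → ℕ → ℕ}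
    (h : IsGood ω) : IsGeneric S fun i => W.path (ω i) := by
  have hjump : ∀ I : Set ℕ, I.Finite → ∀ᶠ N in atTop, ∀ i ∈ I, ∀ n ≥ N, ω i n < 2 := fun I hI =>
    (eventually_all_finite hI).2 fun i _ => by
      obtain ⟨N, hN⟩ := eventually_atTop.1 (h.eventually_lt i)
      exact eventually_atTop.2 ⟨N, fun m hm n hn => hN n (hm.trans hn)⟩
  have hne : ∀ i j, i ≠ j → ∀ᶠ n in atTop, W.path (ω i) n ≠ W.path (ω j) n := by
    intro i j hij
    obtain ⟨N, hN⟩ := (hjump {i, j} (Set.toFinite _)).exists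
    have hiN := hN i (Or.inl rfl)
    have hjN := hN j (Or.inr rfl)
    obtain ⟨n₀, hn₀, hd⟩ : ∃ n₀ ≥ N, W.path (ω i) n₀ ≠ W.path (ω j) n₀ := by
      obtain ⟨n, hn, hc⟩ := frequently_atTop.1 (h.frequently_ne i j hij) N
      by_cases heq : W.path (ω i) n = W.path (ω j) n
      · refine ⟨n + 1, le_trans hn n.le_succ, ?_⟩
        have hd := W.dup_notMem n _ (W.path_mem (ω j) n)
        have hm := W.path_mem (ω j) n
        rw [W.path_succ_of_lt (hiN n hn), W.path_succ_of_lt (hjN n hn), heq]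
        split_ifs with h1 h2 h2
        · exact (hc (by simp [h1, h2])).elim
        · exact fun h => hd (h.symm ▸ hm)
        · exact fun h => hd (h ▸ hm)
        · exact (hc (by simp [h1, h2])).elim
      · exact ⟨n, hn, heq⟩
    refine eventually_atTop.2 ⟨n₀, fun n hn heq => hij ?_⟩
    refine W.path_injOn (I := {i, j}) (fun k hk m hm => hN k hk m (le_trans hn₀ hm)) ?_ hn
      (Or.inl rfl) (Or.inr rfl) heq
    rw [Set.injOn_pair]
    exact fun h => (hd h).elim
  have hinj : ∀ I : Set ℕ, I.Finite → ∀ᶠ n in atTop, I.InjOn fun i => W.path (ω i) n := by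
    intro I hI
    have : ∀ᶠ n in atTop, ∀ i ∈ I, ∀ j ∈ I, i ≠ j → W.path (ω i) n ≠ W.path (ω j) n :=
      (eventually_all_finite hI).2 fun i _ => (eventually_all_finite hI).2 fun j _ => by
        by_cases hij : i = j
        · simp [hij]
        · simpa [hij] using hne i j hij
    exact this.mono fun n hn i hi j hj hij => by_contra fun hc => hn i hi j hj hc hij
  refine ⟨hne, fun φ hφ v => ?_, fun φ hφ i v hex => ?_⟩
  · obtain ⟨k, hk⟩ := W.exists_mem_forms φ hφ
    have hfin := (freeVars_finite hφ).image v
    obtain ⟨n₀, h1, h2, h3⟩ := ((hjump _ hfin).and ((hinj _ hfin).and (eventually_ge_atTop k))).exists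
    have key := fun n (hn : n₀ ≤ n) => W.sat_path h1 h2 (W.forms_mono h3 hk) (v := v)
      (fun i hi => ⟨i, hi, rfl⟩) hn
    by_cases hs : Sat S φ fun i => W.path (ω (v i)) n₀
    · exact Or.inl (eventually_atTop.2 ⟨n₀, fun n hn => (key n hn).2 hs⟩)
    · exact Or.inr (eventually_atTop.2 ⟨n₀, fun n hn => (key n hn).not.2 hs⟩)
  · obtain ⟨k, hk⟩ := W.exists_mem_forms φ hφ
    set I := v '' freeVars φ with hI
    have hfin : I.Finite := (freeVars_finite hφ).image v
    obtain ⟨N, hN⟩ := eventually_atTop.1 hex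
    obtain ⟨n, h1, h2, h3, h4⟩ := ((hjump _ hfin).and ((hinj _ hfin).and
      ((eventually_ge_atTop k).and (eventually_ge_atTop N)))).exists
    have h5 : I.InjOn fun i => W.path (ω i) (n + 1) :=
      W.path_injOn_succ (fun i hi => h1 i hi n le_rfl) h2
    let u : ℕ → M := fun j =>
      if v j ∈ I then W.path (ω (v j)) (n + 1) else W.path (ω (v j)) n
    have hu : ∀ j, u j ∈ W.carrier n ∪ W.dup n '' W.carrier n := by
      intro j
      simp only [u]
      split_ifs with hj
      · exact W.path_succ_mem (h1 _ hj n le_rfl)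
      · exact Or.inl (W.path_mem _ _)
    have hcongr : ∀ b, Sat S φ (Function.update u i b) ↔
        Sat S φ (Function.update (fun i => W.path (ω (v i)) (n + 1)) i b) := by
      refine fun b => sat_congr S φ fun j hj => ?_
      by_cases hji : j = i
      · subst hji; simp
      · simp [Function.update_of_ne hji, u, show v j ∈ I from ⟨j, hj, rfl⟩]
    obtain ⟨a, ha⟩ := hN (n + 1) (h4.trans n.le_succ)
    obtain ⟨b, hb, hsat⟩ := W.exists_witness n φ (W.forms_mono h3 hk) i u hu ⟨a, (hcongr a).2 ha⟩
    obtain ⟨j, hj1, hj2, hj3⟩ : ∃ j, W.path (ω j) (n + 1) = b ∧ (∀ m ≥ n + 1, ω j m < 2) ∧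
        (insert j I).InjOn fun i => W.path (ω i) (n + 1) := by
      by_cases hbI : ∃ j ∈ I, W.path (ω j) (n + 1) = b
      · obtain ⟨j, hj, hjb⟩ := hbI
        refine ⟨j, hjb, fun m hm => h1 j hj m (n.le_succ.trans hm), ?_⟩
        rwa [Set.insert_eq_of_mem hj]
      · obtain ⟨t, rfl⟩ : ∃ t, W.enum (n + 1) t = b := by
          rwa [← W.range_enum (n + 1)] at hb
        obtain ⟨j, hj, hjm⟩ := h.exists_jump n t
        have hjb := W.path_succ_of_jump hj
        have hjI : j ∉ I := fun hjI => hbI ⟨j, hjI, hjb⟩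
        refine ⟨j, hjb, fun m hm => hjm m hm, (Set.injOn_insert hjI).2 ⟨h5, ?_⟩⟩
        rintro ⟨i, hi, hij⟩
        exact hbI ⟨i, hi, Eq.trans hij hjb⟩
    refine ⟨j, eventually_atTop.2 ⟨n + 1, fun m hm => ?_⟩⟩
    refine (W.sat_path (I := insert j I) (n₀ := n + 1) ?_ hj3
      (W.forms_mono (h3.trans n.le_succ) hk) (fun l hl => ?_) hm).2 ?_
    · rintro l (rfl | hl) m hm
      · exact hj2 m hm
      · exact h1 l hl m (n.le_succ.trans hm)
    · by_cases hli : l = i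
      · simp [hli]
      · rw [Function.update_of_ne hli]
        exact Or.inr ⟨l, hl, rfl⟩
    · refine (sat_congr S φ fun l hl => ?_).1 ((hcongr b).1 hsat)
      by_cases hli : l = i
      · subst hli; simp [hj1]
      · simp [Function.update_of_ne hli]

/-! ### Limit structures -/

section Limit

open Language Structure

variable {M : Type} (S : L.Structure M)

/-- The indices of sequences eventually equal to the value of `f` at the sequences indexed by `t`. -/
def limValues (F : ℕ → ℕ → M) {n : ℕ} (f : L.Functions n) (t : Fin n → ℕ) : Set ℕ :=
  {j | ∀ᶠ k in atTop, funMap f (fun i => F (t i) k) = F j k}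

open Classical in
/-- The structure on the indices of a generic family of sequences in which every atomic formula has
its eventual truth value. -/
noncomputable def limStr (F : ℕ → ℕ → M) : Str L where
  func _ f t := sInf (limValues S F f t)
  rel _ R t := decide (∀ᶠ k in atTop, RelMap R fun i => F (t i) k)

variable {S}

lemma limStr_rel_eq_true (F : ℕ → ℕ → M) {n : ℕ} (R : L.Relations n) (t : Fin n → ℕ) :
    (limStr S F).rel n R t = true ↔ ∀ᶠ k in atTop, RelMap R fun i => F (t i) k := by
  simp [limStr]

variable {F : ℕ → ℕ → M} (h : IsGeneric S F)

namespace IsGeneric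

include h

lemma index_unique {a : ℕ → M} {i j : ℕ} (hi : ∀ᶠ k in atTop, a k = F i k)
    (hj : ∀ᶠ k in atTop, a k = F j k) : i = j := by
  by_contra hij
  obtain ⟨k, h1, h2, h3⟩ := (hi.and (hj.and (h.eventually_ne i j hij))).exists
  exact h3 (h1.symm.trans h2)

lemma limValues_nonempty {n : ℕ} (f : L.Functions n) (t : Fin n → ℕ) :
    (limValues S F f t).Nonempty := by
  let φ : InfForm L := .equal (.func f fun i => .var i) (.var n)
  let v : ℕ → ℕ := fun i => if h : i < n then t ⟨i, h⟩ else 0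
  obtain ⟨j, hj⟩ := h.exists_witness φ trivial n v (Eventually.of_forall fun k =>
    ⟨funMap f fun i => F (t i) k, by
      simp only [φ, Sat, Term.realize, Function.update_self]
      congr 1
      funext i
      rw [Function.update_of_ne i.2.ne]
      simp [v]⟩)
  refine ⟨j, hj.mono fun k hk => ?_⟩
  simp only [φ, Sat, Term.realize, Function.update_self] at hk
  rw [← hk]
  congr 1
  funext i
  rw [Function.update_of_ne i.2.ne]
  simp [v]

lemma limStr_func_mem {n : ℕ} (f : L.Functions n) (t : Fin n → ℕ) :
    (limStr S F).func n f t ∈ limValues S F f t :=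
  Nat.sInf_mem (h.limValues_nonempty f t)

lemma realize_limStr (t : L.Term ℕ) (v : ℕ → ℕ) : ∀ᶠ k in atTop,
    t.realize (fun i => F (v i) k) =
      F (@Term.realize L ℕ (limStr S F).toStructure ℕ v t) k := by
  induction t with
  | var i => exact Eventually.of_forall fun _ => rfl
  | func f ts ih =>
    have h1 := h.limStr_func_mem f fun i => @Term.realize L ℕ (limStr S F).toStructure ℕ v (ts i)
    filter_upwards [h1, eventually_all.2 ih] with k h1 h2
    simp only [Term.realize, h2]
    exact h1

lemma sat_limStr {φ : InfForm L} (hφ : IsFirstOrder φ) (v : ℕ → ℕ) :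
    Sat (limStr S F).toStructure φ v ↔ ∀ᶠ k in atTop, Sat S φ fun i => F (v i) k := by
  induction φ generalizing v with
  | equal t₁ t₂ =>
    simp only [Sat]
    constructor
    · intro heq
      filter_upwards [h.realize_limStr t₁ v, h.realize_limStr t₂ v] with k h1 h2
      rw [h1, h2, heq]
    · intro heq
      refine h.index_unique (h.realize_limStr t₁ v) ?_
      filter_upwards [heq, h.realize_limStr t₂ v] with k h1 h2
      rw [h1, h2]
  | rel R ts =>
    have hR : ∀ᶠ k in atTop, (fun i => (ts i).realize fun i => F (v i) k) =
        fun i => F (@Term.realize L ℕ (limStr S F).toStructure ℕ v (ts i)) k :=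
      (eventually_all.2 fun i => h.realize_limStr (ts i) v).mono fun k hk => funext hk
    simp only [Sat]
    refine (limStr_rel_eq_true F R _).trans (eventually_congr (hR.mono fun k hk => ?_))
    rw [hk]
  | not φ ih =>
    simp only [Sat, ih hφ v]
    rcases h.decides φ hφ v with hd | hd
    · simp only [hd, not_true_eq_false, false_iff]
      intro hd'
      obtain ⟨k, h1, h2⟩ := (hd.and hd').exists
      exact h2 h1
    · simp only [hd, iff_true]
      intro hd'
      obtain ⟨k, h1, h2⟩ := (hd.and hd').exists
      exact h1 h2
  | and φ ψ ih₁ ih₂ => simp only [Sat, ih₁ hφ.1 v, ih₂ hφ.2 v, eventually_and]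
  | iand f => exact hφ.elim
  | ex i φ ih =>
    simp only [Sat, ih hφ]
    refine ⟨fun ⟨j, hj⟩ => hj.mono fun k hk => ⟨F j k, ?_⟩, h.exists_witness φ hφ i v⟩
    convert hk using 1
    funext l
    by_cases hl : l = i
    · subst hl; simp
    · simp [Function.update_of_ne hl]

lemma isModel_limStr {T : Set (InfForm L)} (hT : ∀ φ ∈ T, IsFirstOrder φ)
    (hS : IsModel S T) : limStr S F ∈ modelSet T := fun φ hφ v =>
  (h.sat_limStr (hT φ hφ) v).2 (Eventually.of_forall fun _ => hS φ hφ _)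

lemma permStr_limStr (g : Equiv.Perm ℕ) :
    permStr g (limStr S F) = limStr S fun i => F (g.symm i) := by
  simp only [permStr, limStr, Str.mk.injEq, and_true]
  funext n f t
  have h1 := h.limStr_func_mem f fun i => g.symm (t i)
  have h2 : limValues S (fun i => F (g.symm i)) f t =
      {g ((limStr S F).func n f fun i => g.symm (t i))} := by
    refine Set.eq_singleton_iff_unique_mem.2 ⟨?_, fun j hj => ?_⟩
    · simpa [limValues] using h1
    · rw [← h.index_unique hj h1, Equiv.apply_symm_apply]
  rw [h2, csInf_singleton]
  rfl

end IsGeneric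

end Limit

/-! ### Random instructions -/

section Random

open scoped ENNReal

/-- The geometric distribution on `ℕ` with parameter `1 / 2`. -/
noncomputable def geomMeasure : Measure ℕ :=
  Measure.sum fun k => (2⁻¹ : ℝ≥0∞) ^ (k + 1) • Measure.dirac k

lemma geomMeasure_univ : geomMeasure Set.univ = 1 := by
  simp only [geomMeasure, Measure.sum_apply _ MeasurableSet.univ, Measure.smul_apply, measure_univ,
    smul_eq_mul, mul_one]
  rw [ENNReal.tsum_geometric_add_one, ENNReal.one_sub_inv_two, inv_inv]
  exact ENNReal.inv_mul_cancel (by norm_num) (by norm_num)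

lemma geomMeasure_singleton_ne_zero (k : ℕ) : geomMeasure {k} ≠ 0 := by
  refine (lt_of_lt_of_le ?_ (Measure.le_sum_apply _ {k})).ne'
  refine lt_of_lt_of_le ?_ (ENNReal.le_tsum k)
  simpa using ENNReal.pow_pos (ENNReal.inv_pos.2 ENNReal.ofNat_ne_top) (k + 1)

/-- The distribution of the `n`-th instruction: stay and duplicate have probability about `1 / 2`
each, jumps have total probability `2⁻¹ ^ (n + 2)`. -/
noncomputable def stepMeasure (n : ℕ) : Measure ℕ :=
  (2⁻¹ : ℝ≥0∞) • Measure.dirac 1 + (2⁻¹ - 2⁻¹ ^ (n + 2) : ℝ≥0∞) • Measure.dirac 0 +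
    (2⁻¹ ^ (n + 2) : ℝ≥0∞) • geomMeasure.map (· + 2)

lemma stepMeasure_apply (n : ℕ) (s : Set ℕ) : stepMeasure n s =
    2⁻¹ * s.indicator 1 1 + (2⁻¹ - 2⁻¹ ^ (n + 2)) * s.indicator 1 0 +
      2⁻¹ ^ (n + 2) * geomMeasure ((· + 2) ⁻¹' s) := by
  simp only [stepMeasure, Measure.add_apply, Measure.smul_apply, smul_eq_mul,
    Measure.dirac_apply' _ (MeasurableSet.of_discrete (s := s)),
    Measure.map_apply (measurable_of_countable _) (MeasurableSet.of_discrete (s := s))]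

instance (n : ℕ) : IsProbabilityMeasure (stepMeasure n) where
  measure_univ := by
    have h : (2⁻¹ : ℝ≥0∞) ^ (n + 2) ≤ 2⁻¹ := by
      rw [pow_succ]
      exact mul_le_of_le_one_left' (pow_le_one₀ zero_le (by norm_num))
    rw [stepMeasure_apply]
    simp only [Set.indicator_univ, Pi.one_apply, mul_one, Set.preimage_univ, geomMeasure_univ]
    rw [add_assoc, tsub_add_cancel_of_le h, ENNReal.inv_two_add_inv_two]

lemma stepMeasure_singleton_one (n : ℕ) : stepMeasure n {1} = 2⁻¹ := by
  have : (· + 2) ⁻¹' ({1} : Set ℕ) = ∅ := by ext; simp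
  rw [stepMeasure_apply, this]
  simp

lemma stepMeasure_Ici_two (n : ℕ) : stepMeasure n {k | ¬ k < 2} = 2⁻¹ ^ (n + 2) := by
  have : (· + 2) ⁻¹' {k : ℕ | ¬ k < 2} = Set.univ := by
    ext k
    exact ⟨fun _ => trivial, fun _ => show ¬ k + 2 < 2 by omega⟩
  rw [stepMeasure_apply, this, geomMeasure_univ]
  simp

lemma stepMeasure_singleton_ne_zero (n t : ℕ) : stepMeasure n {t + 2} ≠ 0 := by
  have : (· + 2) ⁻¹' ({t + 2} : Set ℕ) = {t} := by ext; simp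
  rw [stepMeasure_apply, this]
  simp [geomMeasure_singleton_ne_zero]

/-- A product event with infinitely many factors of measure bounded away from `1` is null. -/
lemma infinitePi_forall_ge_null {X : ℕ → Type*} [∀ i, MeasurableSpace (X i)]
    (P : ∀ i, Measure (X i)) [∀ i, IsProbabilityMeasure (P i)] {s : ∀ i, Set (X i)}
    (hs : ∀ i, MeasurableSet (s i)) {c : ℝ≥0∞} (hc : c < 1) {N : ℕ} (hP : ∀ i ≥ N, P i (s i) ≤ c) :
    Measure.infinitePi P {x | ∀ i ≥ N, x i ∈ s i} = 0 := by
  refine le_antisymm (ge_of_tendsto' (ENNReal.tendsto_pow_atTop_nhds_zero_of_lt_one hc)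
    fun K => ?_) zero_le
  calc Measure.infinitePi P {x | ∀ i ≥ N, x i ∈ s i}
      ≤ Measure.infinitePi P (Set.pi (Finset.Ico N (N + K)) s) :=
        measure_mono fun x hx i hi => hx i (Finset.mem_Ico.1 hi).1
    _ = ∏ i ∈ Finset.Ico N (N + K), P i (s i) := Measure.infinitePi_pi _ fun i _ => hs i
    _ ≤ ∏ i ∈ Finset.Ico N (N + K), c :=
        Finset.prod_le_prod' fun i hi => hP i (Finset.mem_Ico.1 hi).1
    _ = c ^ K := by simp

/-- The distribution of the instructions for a single path. -/
noncomputable def rowMeasure : Measure (ℕ → ℕ) := Measure.infinitePi stepMeasure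

noncomputable instance : IsProbabilityMeasure rowMeasure :=
  inferInstanceAs (IsProbabilityMeasure (Measure.infinitePi stepMeasure))

/-- The distribution of independent instructions for countably many paths. -/
noncomputable def arrayMeasure : Measure (ℕ → ℕ → ℕ) := Measure.infinitePi fun _ => rowMeasure

noncomputable instance : IsProbabilityMeasure arrayMeasure :=
  inferInstanceAs (IsProbabilityMeasure (Measure.infinitePi fun _ => rowMeasure))

lemma ae_array_of_ae_row {p : (ℕ → ℕ) → Prop} (h : ∀ᵐ r ∂rowMeasure, p r) (i : ℕ) :
    ∀ᵐ ω ∂arrayMeasure, p (ω i) := by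
  have hmap : arrayMeasure.map (fun ω => ω i) = rowMeasure := Measure.infinitePi_map_eval _ i
  rw [← hmap] at h
  exact ae_of_ae_map (measurable_pi_apply i).aemeasurable h

lemma rowMeasure_eval (n : ℕ) (s : Set ℕ) : rowMeasure {r | r n ∈ s} = stepMeasure n s := by
  have hmap : rowMeasure.map (fun r => r n) = stepMeasure n := Measure.infinitePi_map_eval _ n
  rw [← hmap, Measure.map_apply (measurable_pi_apply n) MeasurableSet.of_discrete]
  rfl

lemma tsum_two_inv_pow_add_two : ∑' n : ℕ, (2⁻¹ : ℝ≥0∞) ^ (n + 2) = 2⁻¹ := by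
  have : ∀ n : ℕ, (2⁻¹ : ℝ≥0∞) ^ (n + 2) = 2⁻¹ ^ (n + 1) * 2⁻¹ := fun n => pow_succ _ _
  simp only [this, ENNReal.tsum_mul_right, ENNReal.tsum_geometric_add_one, ENNReal.one_sub_inv_two,
    inv_inv]
  rw [ENNReal.inv_mul_cancel (by norm_num) (by norm_num), one_mul]

lemma ae_row_eventually_lt : ∀ᵐ r ∂rowMeasure, ∀ᶠ n in atTop, r n < 2 := by
  have h : ∑' n, rowMeasure {r | r n ∈ {k | ¬ k < 2}} ≠ ∞ := by
    simp only [rowMeasure_eval, stepMeasure_Ici_two, tsum_two_inv_pow_add_two]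
    norm_num
  filter_upwards [ae_eventually_notMem h] with r hr
  exact hr.mono fun n hn => not_not.1 hn

lemma ae_row_coin_ne (N : ℕ) (r : ℕ → ℕ) :
    rowMeasure {r' | ∀ n ≥ N, (r n = 1 ↔ r' n = 1)} = 0 := by
  refine infinitePi_forall_ge_null stepMeasure (s := fun n => {k | r n = 1 ↔ k = 1})
    (fun _ => MeasurableSet.of_discrete) ENNReal.one_half_lt_one fun n _ => ?_
  have h1 := stepMeasure_singleton_one n
  by_cases h : r n = 1
  · simp only [h, true_iff]
    exact h1.le
  · have h2 : {k | r n = 1 ↔ k = 1} = ({1} : Set ℕ)ᶜ := by ext; simp [h]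
    rw [h2, prob_compl_eq_one_sub MeasurableSet.of_discrete, h1, ENNReal.one_sub_inv_two]

lemma ae_array_frequently_ne {i j : ℕ} (hij : i ≠ j) :
    ∀ᵐ ω ∂arrayMeasure, ∃ᶠ n in atTop, ¬ (ω i n = 1 ↔ ω j n = 1) := by
  simp only [frequently_atTop, ae_all_iff]
  intro N
  have hmap : arrayMeasure.map (fun ω => (ω i, ω j)) = rowMeasure.prod rowMeasure :=
    Measure.infinitePi_map_eval_prod hij
  have hmeas : MeasurableSet {p : (ℕ → ℕ) × (ℕ → ℕ) | ∀ n ≥ N, (p.1 n = 1 ↔ p.2 n = 1)} := by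
    simp only [Set.ofPred_forall]
    refine MeasurableSet.iInter fun n => MeasurableSet.iInter fun _ => ?_
    have hm : Measurable fun p : (ℕ → ℕ) × (ℕ → ℕ) => (p.1 n, p.2 n) := by fun_prop
    exact hm (MeasurableSet.of_discrete (s := {q : ℕ × ℕ | q.1 = 1 ↔ q.2 = 1}))
  have h0 : arrayMeasure {ω | ∀ n ≥ N, (ω i n = 1 ↔ ω j n = 1)} = 0 := by
    have h1 := Measure.measure_prod_null_of_ae_null (μ := rowMeasure) (ν := rowMeasure) hmeas
      (Eventually.of_forall fun r => ae_row_coin_ne N r)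
    rw [← hmap, Measure.map_apply (by fun_prop) hmeas] at h1
    exact h1
  refine measure_mono_null (t := {ω | ∀ n ≥ N, (ω i n = 1 ↔ ω j n = 1)}) (fun ω hω n hn => ?_) h0
  by_contra hc
  exact hω ⟨n, hn, hc⟩

lemma rowMeasure_jump_ne_zero (n t : ℕ) :
    rowMeasure {r | r n = t + 2 ∧ ∀ m > n, r m < 2} ≠ 0 := by
  intro h0
  set p := stepMeasure n {t + 2} with hp
  have hB : ∀ m, rowMeasure {r | r n = t + 2 ∧ m ≠ n ∧ ¬ r m < 2} ≤ p * 2⁻¹ ^ (m + 2) := by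
    intro m
    by_cases hmn : m = n
    · simp [hmn]
    · have h1 : rowMeasure (Set.pi ({n, m} : Finset ℕ)
          fun i => if i = n then {t + 2} else {k | ¬ k < 2}) = _ :=
        Measure.infinitePi_pi stepMeasure fun _ _ => MeasurableSet.of_discrete
      rw [Finset.prod_pair (Ne.symm hmn), if_pos rfl, if_neg hmn, stepMeasure_Ici_two] at h1
      rw [← h1]
      refine measure_mono fun r hr i hi => ?_
      simp only [Finset.coe_insert, Finset.coe_singleton, Set.mem_insert_iff,
        Set.mem_singleton_iff] at hi
      rcases hi with rfl | rfl
      · simpa using hr.1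
      · change r i ∈ if i = n then _ else _
        rw [if_neg hmn]
        exact hr.2.2
  have hle : p ≤ p * 2⁻¹ := calc
    p = rowMeasure {r | r n ∈ ({t + 2} : Set ℕ)} := (rowMeasure_eval n _).symm
    _ ≤ rowMeasure ({r | r n = t + 2 ∧ ∀ m > n, r m < 2} ∪
          ⋃ m, {r | r n = t + 2 ∧ m ≠ n ∧ ¬ r m < 2}) := by
        refine measure_mono fun r hr => ?_
        by_cases hr' : ∀ m > n, r m < 2
        · exact Or.inl ⟨hr, hr'⟩
        · push Not at hr'
          obtain ⟨m, hm, hm'⟩ := hr'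
          exact Or.inr (Set.mem_iUnion.2 ⟨m, hr, hm.ne', hm'.not_gt⟩)
    _ ≤ 0 + ∑' m, p * 2⁻¹ ^ (m + 2) := by
        refine (measure_union_le _ _).trans (add_le_add h0.le ?_)
        exact (measure_iUnion_le (μ := rowMeasure)
          fun m => {r | r n = t + 2 ∧ m ≠ n ∧ ¬ r m < 2}).trans (ENNReal.tsum_le_tsum hB)
    _ = p * 2⁻¹ := by rw [zero_add, ENNReal.tsum_mul_left, tsum_two_inv_pow_add_two]
  rw [← ENNReal.div_eq_inv_mul.trans (mul_comm _ _)] at hle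
  exact (ENNReal.half_lt_self (stepMeasure_singleton_ne_zero n t) (measure_ne_top _ _)).not_ge hle

lemma ae_array_exists_jump (n t : ℕ) :
    ∀ᵐ ω ∂arrayMeasure, ∃ i, ω i n = t + 2 ∧ ∀ m > n, ω i m < 2 := by
  set E : Set (ℕ → ℕ) := {r | r n = t + 2 ∧ ∀ m > n, r m < 2} with hE
  have hmeas : MeasurableSet E := by
    simp only [hE, Set.ofPred_and, Set.ofPred_forall]
    exact (measurable_pi_apply n (MeasurableSet.of_discrete (s := {t + 2}))).inter
      (MeasurableSet.iInter fun m => MeasurableSet.iInter fun _ : m > n =>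
        measurable_pi_apply m (MeasurableSet.of_discrete (s := {k | k < 2})))
  have hlt : rowMeasure Eᶜ < 1 := by
    rw [prob_compl_eq_one_sub hmeas]
    exact ENNReal.sub_lt_self ENNReal.one_ne_top one_ne_zero (rowMeasure_jump_ne_zero n t)
  have h0 := infinitePi_forall_ge_null (fun _ : ℕ => rowMeasure) (s := fun _ => Eᶜ) (N := 0)
    (fun _ => hmeas.compl) hlt fun _ _ => le_rfl
  refine measure_mono_null (t := {ω | ∀ i ≥ 0, ω i ∈ Eᶜ}) (fun ω hω i _ hi => ?_) h0
  exact hω ⟨i, hi⟩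

lemma ae_isGood : ∀ᵐ ω ∂arrayMeasure, IsGood ω := by
  have h1 := ae_all_iff.2 fun i => ae_array_of_ae_row ae_row_eventually_lt i
  have h2 : ∀ᵐ ω ∂arrayMeasure, ∀ i j, i ≠ j → ∃ᶠ n in atTop, ¬ (ω i n = 1 ↔ ω j n = 1) := by
    simp only [ae_all_iff]
    exact fun i j hij => ae_array_frequently_ne hij
  have h3 := ae_all_iff.2 fun n => ae_all_iff.2 fun t => ae_array_exists_jump n t
  filter_upwards [h1, h2, h3] with ω h1 h2 h3
  exact ⟨h1, h2, h3⟩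

lemma map_reindex_arrayMeasure (g : Equiv.Perm ℕ) :
    arrayMeasure.map (fun ω i => ω (g i)) = arrayMeasure :=
  Measure.map_infinitePi_infinitePi_of_inj g.injective

end Random

/-! ### The random limit structure -/

lemma measurable_permStr (g : Equiv.Perm ℕ) : Measurable (permStr (L := L) g) := by
  refine measurable_generateFrom ?_
  rintro _ (⟨n, f, t, k, rfl⟩ | ⟨n, R, t, rfl⟩)
  · refine MeasurableSpace.measurableSet_generateFrom
      (Or.inl ⟨n, f, fun i => g.symm (t i), g.symm k, ?_⟩)
    ext M
    exact g.eq_symm_apply.symm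
  · exact MeasurableSpace.measurableSet_generateFrom (Or.inr ⟨n, R, fun i => g.symm (t i), rfl⟩)

lemma measurableSet_eventually_of_forall {Ω : Type*} [MeasurableSpace Ω] {p : ℕ → Ω → Prop}
    (h : ∀ k, MeasurableSet {ω | p k ω}) : MeasurableSet {ω | ∀ᶠ k in atTop, p k ω} := by
  simp only [eventually_atTop, Set.ofPred_exists, Set.ofPred_forall]
  exact MeasurableSet.iUnion fun N => MeasurableSet.iInter fun k => MeasurableSet.iInter fun _ => h k

lemma measurableSet_sInf_eq {Ω : Type*} [MeasurableSpace Ω] {s : Ω → Set ℕ}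
    (h : ∀ j, MeasurableSet {ω | j ∈ s ω}) (k : ℕ) : MeasurableSet {ω | sInf (s ω) = k} := by
  have heq : {ω | sInf (s ω) = k} =
      ({ω | k ∈ s ω} ∩ ⋂ j, ⋂ (_ : j < k), {ω | j ∈ s ω}ᶜ) ∪
        ({_ω | k = 0} ∩ ⋂ j, {ω | j ∈ s ω}ᶜ) := by
    ext ω
    simp only [Set.mem_union, Set.mem_inter_iff, Set.mem_iInter, Set.mem_compl_iff,
      Set.mem_ofPred_eq]
    constructor
    · rintro rfl
      rcases (s ω).eq_empty_or_nonempty with he | hne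
      · exact Or.inr (by simp [he])
      · exact Or.inl ⟨Nat.sInf_mem hne, fun j hj => Nat.notMem_of_lt_sInf hj⟩
    · rintro (⟨h1, h2⟩ | ⟨rfl, h2⟩)
      · exact le_antisymm (Nat.sInf_le h1)
          (not_lt.1 fun hlt => h2 _ hlt (Nat.sInf_mem ⟨k, h1⟩))
      · rw [Set.eq_empty_of_forall_notMem h2, Nat.sInf_empty]
  rw [heq]
  exact ((h k).inter (MeasurableSet.iInter fun j => MeasurableSet.iInter fun _ => (h j).compl)).union
    ((MeasurableSet.const _).inter (MeasurableSet.iInter fun j => (h j).compl))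

namespace Tower

variable {M : Type} {S : L.Structure M} (W : Tower S)

lemma measurableSet_path {ι : Type*} [Finite ι] (t : ι → ℕ) (k : ℕ) (p : (ι → M) → Prop) :
    MeasurableSet {ω : ℕ → ℕ → ℕ | p fun i => W.path (ω (t i)) k} := by
  let H : (ℕ → ℕ → ℕ) → ι → Fin k → ℕ := fun ω i m => ω (t i) m
  let G : (ι → Fin k → ℕ) → ι → M := fun x i =>
    W.path (fun m => if h : m < k then x i ⟨m, h⟩ else 0) k
  have hH : Measurable H := by
    refine measurable_pi_iff.2 fun i => measurable_pi_iff.2 fun m => ?_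
    exact (measurable_pi_apply (m : ℕ)).comp (measurable_pi_apply (t i))
  have hGH : ∀ ω, (fun i => W.path (ω (t i)) k) = G (H ω) := fun ω =>
    funext fun i => W.path_congr fun m hm => by simp [H, hm]
  simp only [hGH]
  exact hH (MeasurableSet.of_discrete (s := {x | p (G x)}))

/-- The limit structure determined by the instructions `ω`. -/
noncomputable def limit (ω : ℕ → ℕ → ℕ) : Str L := limStr S fun i => W.path (ω i)

lemma measurable_limit : Measurable W.limit := by
  refine measurable_generateFrom ?_
  rintro _ (⟨n, f, t, k, rfl⟩ | ⟨n, R, t, rfl⟩)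
  · refine measurableSet_sInf_eq (fun j => measurableSet_eventually_of_forall fun m => ?_) k
    exact W.measurableSet_path (fun o : Option (Fin n) => o.elim j t) m
      fun x => S.funMap f (fun i => x (some i)) = x none
  · have heq : W.limit ⁻¹' {M : Str L | M.rel n R t = true} =
        {ω | ∀ᶠ k in atTop, S.RelMap R fun i => W.path (ω (t i)) k} := by
      ext ω
      exact limStr_rel_eq_true _ R t
    rw [heq]
    exact measurableSet_eventually_of_forall fun m => W.measurableSet_path t m fun x => S.RelMap R x

/-- The distribution of the random limit structure. -/
noncomputable def limitMeasure : Measure (Str L) := arrayMeasure.map W.limit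

instance : IsProbabilityMeasure W.limitMeasure :=
  Measure.isProbabilityMeasure_map W.measurable_limit.aemeasurable

lemma isInvariant_limitMeasure : IsInvariant W.limitMeasure := by
  intro g s hs
  have hre : Measurable fun (ω : ℕ → ℕ → ℕ) i => ω (g.symm i) :=
    measurable_pi_iff.2 fun i => measurable_pi_apply _
  rw [limitMeasure, Measure.map_apply W.measurable_limit (measurable_permStr g hs),
    Measure.map_apply W.measurable_limit hs]
  calc arrayMeasure (W.limit ⁻¹' (permStr g ⁻¹' s))
      = arrayMeasure ((fun ω i => ω (g.symm i)) ⁻¹' (W.limit ⁻¹' s)) := by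
        refine measure_congr (ae_isGood.mono fun ω hω => ?_)
        have h := (hω.isGeneric W).permStr_limStr g
        exact congrArg (· ∈ s) h
    _ = arrayMeasure (W.limit ⁻¹' s) := by
        rw [← Measure.map_apply hre (W.measurable_limit hs), map_reindex_arrayMeasure]

lemma limitMeasure_modelSet {T : Set (InfForm L)} (hT : ∀ φ ∈ T, IsFirstOrder φ)
    (hS : IsModel S T) : W.limitMeasure (modelSet T) = 1 := by
  refine le_antisymm prob_le_one ?_
  have hae : ∀ᵐ ω ∂arrayMeasure, ω ∈ W.limit ⁻¹' modelSet T :=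
    ae_isGood.mono fun ω hω => (hω.isGeneric W).isModel_limStr hT hS
  have h1 : arrayMeasure (W.limit ⁻¹' modelSet T) = 1 :=
    (measure_congr (eventuallyEq_univ.2 hae)).trans measure_univ
  exact h1.symm.le.trans (Measure.le_map_apply W.measurable_limit.aemeasurable _)

end Tower

theorem statement1 (L : FirstOrder.Language.{0,0})
    [Countable (Σ n, L.Functions n)] [Countable (Σ n, L.Relations n)]
    (Sig : Set (InfForm L)) (hfo : ∀ φ ∈ Sig, IsFirstOrder φ ∧ IsSentence φ) :
    (∃ μ : Measure (Str L), IsProbabilityMeasure μ ∧ IsInvariant μ ∧ μ (modelSet Sig) = 1) ↔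
    (∃ T : Set (InfForm L), (∀ φ ∈ T, IsFirstOrder φ ∧ IsSentence φ) ∧ Consistent T ∧
      (∀ φ : InfForm L, IsFirstOrder φ → IsSentence φ →
        (Consequence T φ ∨ Consequence T (InfForm.not φ))) ∧
      Sig ⊆ T ∧ HasTrivialDcl {φ : InfForm L | IsFirstOrder φ} T) := by
  constructor
  · rintro ⟨μ, hμ, hinv, hSig⟩
    exact exists_theory_of_measure hfo μ hinv hSig
  · rintro ⟨T, hT, ⟨M, S, hne, hM⟩, hcomp, hSig, hdcl⟩
    obtain ⟨W⟩ := (hdcl.trivialDclIn hcomp hM).nonempty_tower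
    exact ⟨W.limitMeasure, inferInstance, W.isInvariant_limitMeasure,
      W.limitMeasure_modelSet (fun φ hφ => (hfo φ hφ).1) fun φ hφ => hM φ (hSig hφ)⟩

end AFP
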